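/- arXiv:math/0404435 — 2 statements merged into one kernel-verified Lean document; each statement's English description precedes it below -/
import Mathlib

section
/- Suppose w is continuous on the closure of D, continuously differentiable up to the boundary, twice continuously differentiable in D, quasiperiodic, satisfies Δw + k²w = 0 in D and w = 0 on S, and there exist C, γ > 0 such that |w(x,y)| + |∇w(x,y)| ≤ C e^{−γ y} for all (x,y) ∈ D. Then both integrals below are finite and ∫_{D_L} |∇w|² dx dy = k² ∫_{D_L} |w|² dx dy. -/
open MeasureTheory

open Filter Topology Set

section IndicatorExtension

variable {X : Type*} [TopologicalSpace X] {U : Set X} {g g' : X → ℝ}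

theorem indicator_eventuallyEq_zero {p : X}
    (h : ∀ᶠ q in 𝓝 p, q ∈ U → g q = 0) : U.indicator g =ᶠ[𝓝 p] 0 := by
  filter_upwards [h] with q hq
  exact indicator_apply_eq_zero.2 hq

theorem continuous_indicator_of_eventually_zero (hU : IsOpen U) (hg : ContinuousOn g U)
    (hz : ∀ p ∉ U, ∀ᶠ q in 𝓝 p, q ∈ U → g q = 0) : Continuous (U.indicator g) := by
  refine continuous_iff_continuousAt.2 fun p => ?_
  by_cases hp : p ∈ U
  · exact (hg.continuousAt (hU.mem_nhds hp)).congr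
      ((eqOn_indicator (s := U) (f := g)).symm.eventuallyEq_of_mem (hU.mem_nhds hp))
  · exact continuousAt_const.congr (indicator_eventuallyEq_zero (hz p hp)).symm

theorem hasDerivAt_indicator_comp (hU : IsOpen U) {c : ℝ → X} (hc : Continuous c) (t : ℝ)
    (hg : c t ∈ U → HasDerivAt (fun s => g (c s)) (g' (c t)) t)
    (hz : ∀ p ∉ U, ∀ᶠ q in 𝓝 p, q ∈ U → g q = 0) :
    HasDerivAt (fun s => U.indicator g (c s)) (U.indicator g' (c t)) t := by
  by_cases ht : c t ∈ U
  · rw [indicator_of_mem ht]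
    refine (hg ht).congr_of_eventuallyEq ?_
    filter_upwards [hc.continuousAt.eventually (hU.mem_nhds ht)] with s hs
    exact indicator_of_mem hs _
  · rw [indicator_of_notMem ht]
    exact (hasDerivAt_const t (0 : ℝ)).congr_of_eventuallyEq
      (hc.continuousAt.eventually (indicator_eventuallyEq_zero (hz _ ht)))

end IndicatorExtension

theorem integral_divergence_rectangle_eq_zero {F G F₁ G₂ : ℝ × ℝ → ℝ} {a b c d : ℝ}
    (hab : a ≤ b) (hcd : c ≤ d) (hF₁ : Continuous F₁) (hG₂ : Continuous G₂)
    (hF : ∀ x y, HasDerivAt (fun t => F (t, y)) (F₁ (x, y)) x)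
    (hG : ∀ x y, HasDerivAt (fun t => G (x, t)) (G₂ (x, y)) y)
    (hFab : ∀ y, F (a, y) = F (b, y)) (hGcd : ∀ x, G (x, c) = G (x, d)) :
    ∫ p in Icc a b ×ˢ Icc c d, (F₁ p + G₂ p) = 0 := by
  have hK : IsCompact (Icc a b ×ˢ Icc c d) := isCompact_Icc.prod isCompact_Icc
  have hK' : IsCompact (Icc c d ×ˢ Icc a b) := isCompact_Icc.prod isCompact_Icc
  have hIF : IntegrableOn F₁ (Icc a b ×ˢ Icc c d) := hF₁.continuousOn.integrableOn_compact hK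
  have hIG : IntegrableOn G₂ (Icc a b ×ˢ Icc c d) := hG₂.continuousOn.integrableOn_compact hK
  rw [integral_add hIF hIG]
  have h1 : ∫ p in Icc a b ×ˢ Icc c d, F₁ p = 0 := by
    rw [Measure.volume_eq_prod, ← setIntegral_prod_swap, setIntegral_prod]
    · refine integral_eq_zero_of_ae (Eventually.of_forall fun y => ?_)
      simp only [Prod.swap_prod_mk, Pi.zero_apply]
      rw [integral_Icc_eq_integral_Ioc, ← intervalIntegral.integral_of_le hab,
        intervalIntegral.integral_eq_sub_of_hasDerivAt (fun x _ => hF x y)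
          (Continuous.intervalIntegrable (by fun_prop) _ _), hFab, sub_self]
    · exact ContinuousOn.integrableOn_compact
        (f := fun z : ℝ × ℝ => F₁ z.swap) hK' (hF₁.comp continuous_swap).continuousOn
  have h2 : ∫ p in Icc a b ×ˢ Icc c d, G₂ p = 0 := by
    rw [Measure.volume_eq_prod, setIntegral_prod _ hIG]
    refine integral_eq_zero_of_ae (Eventually.of_forall fun x => ?_)
    simp only [Pi.zero_apply]
    rw [integral_Icc_eq_integral_Ioc, ← intervalIntegral.integral_of_le hcd,
      intervalIntegral.integral_eq_sub_of_hasDerivAt (fun y _ => hG x y)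
        (Continuous.intervalIntegrable (by fun_prop) _ _), hGcd, sub_self]
  rw [h1, h2, add_zero]

theorem volume_setOf_eq_zero_and_deriv_ne_zero (T : Set ℝ) {g g' : ℝ → ℂ}
    (hg : ∀ t ∈ T, HasDerivAt g (g' t) t) : volume {t ∈ T | g t = 0 ∧ g' t ≠ 0} = 0 := by
  refine measure_null_of_locally_null _ fun t ht => ⟨{t}, ?_, by simp⟩
  have h := (hg t ht.1).eventually_ne (c := 0) ht.2.2
  rw [eventually_nhdsWithin_iff] at h
  rw [mem_nhdsWithin_iff_eventually]
  filter_upwards [h] with s hs hsT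
  by_contra hne
  exact hs hne hsT.2.1

section ClosedSet

variable {K : Set (ℝ × ℝ)} {w v : ℝ × ℝ → ℂ}

theorem measurableSet_eq_zero_and_ne_zero (hK : IsClosed K) (hw : ContinuousOn w K)
    (hv : ContinuousOn v K) : MeasurableSet {p ∈ K | w p = 0 ∧ v p ≠ 0} := by
  have h1 := (hw.preimage_isClosed_of_isClosed hK (isClosed_singleton (x := 0))).measurableSet
  have h2 := (hv.preimage_isClosed_of_isClosed hK (isClosed_singleton (x := 0))).measurableSet
  convert h1.diff h2 using 1
  ext p
  simp only [mem_ofPred_eq, Set.mem_sdiff, mem_inter_iff, mem_preimage, mem_singleton_iff]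
  tauto

theorem volume_eq_zero_and_deriv_snd_ne_zero (hK : IsClosed K) (hw : ContinuousOn w K)
    (hv : ContinuousOn v K) (hd : ∀ p ∈ K, HasDerivAt (fun t => w (p.1, t)) (v p) p.2) :
    volume {p ∈ K | w p = 0 ∧ v p ≠ 0} = 0 := by
  rw [Measure.volume_eq_prod, Measure.measure_prod_null
    (measurableSet_eq_zero_and_ne_zero hK hw hv)]
  exact Eventually.of_forall fun x => volume_setOf_eq_zero_and_deriv_ne_zero
    {y | (x, y) ∈ K} (g := fun t => w (x, t)) (g' := fun t => v (x, t)) fun y hy => hd (x, y) hy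

theorem volume_eq_zero_and_deriv_fst_ne_zero (hK : IsClosed K) (hw : ContinuousOn w K)
    (hv : ContinuousOn v K) (hd : ∀ p ∈ K, HasDerivAt (fun t => w (t, p.2)) (v p) p.1) :
    volume {p ∈ K | w p = 0 ∧ v p ≠ 0} = 0 := by
  have hm := measurableSet_eq_zero_and_ne_zero hK hw hv
  rw [Measure.volume_eq_prod, Measure.prod_apply_symm hm, lintegral_eq_zero_iff
    (measurable_measure_prodMk_right hm)]
  exact Eventually.of_forall fun y => volume_setOf_eq_zero_and_deriv_ne_zero
    {x | (x, y) ∈ K} (g := fun t => w (t, y)) (g' := fun t => v (t, y)) fun x hx => hd (x, y) hx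

end ClosedSet

/-- A smooth cutoff vanishing on `(-∞, 1]` and equal to one on `[2, ∞)`. -/
noncomputable def cutoff (t : ℝ) : ℝ := Real.smoothTransition (t - 1)

theorem contDiff_cutoff : ContDiff ℝ 1 cutoff :=
  Real.smoothTransition.contDiff.comp (contDiff_id.sub contDiff_const)

theorem continuous_deriv_cutoff : Continuous (deriv cutoff) :=
  contDiff_cutoff.continuous_deriv le_rfl

theorem hasDerivAt_cutoff (t : ℝ) : HasDerivAt cutoff (deriv cutoff t) t :=
  (contDiff_cutoff.differentiable one_ne_zero t).hasDerivAt

theorem cutoff_of_le_one {t : ℝ} (ht : t ≤ 1) : cutoff t = 0 :=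
  Real.smoothTransition.zero_of_nonpos (by linarith)

theorem cutoff_of_two_le {t : ℝ} (ht : 2 ≤ t) : cutoff t = 1 :=
  Real.smoothTransition.one_of_one_le (by linarith)

theorem deriv_cutoff_of_lt_one {t : ℝ} (ht : t < 1) : deriv cutoff t = 0 := by
  have h : cutoff =ᶠ[𝓝 t] fun _ => 0 := by
    filter_upwards [eventually_lt_nhds ht] with s hs using cutoff_of_le_one hs.le
  simp [h.deriv_eq]

theorem deriv_cutoff_of_two_lt {t : ℝ} (ht : 2 < t) : deriv cutoff t = 0 := by
  have h : cutoff =ᶠ[𝓝 t] fun _ => 1 := by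
    filter_upwards [eventually_gt_nhds ht] with s hs using cutoff_of_two_le hs.le
  simp [h.deriv_eq]

theorem abs_cutoff_le_one (t : ℝ) : |cutoff t| ≤ 1 := by
  rw [cutoff, abs_of_nonneg (Real.smoothTransition.nonneg _)]
  exact Real.smoothTransition.le_one _

theorem exists_abs_mul_deriv_cutoff_le : ∃ B : ℝ, ∀ t, |t * deriv cutoff t| ≤ B := by
  obtain ⟨B, hB⟩ := (isCompact_Icc (a := (0 : ℝ)) (b := 2)).exists_bound_of_continuousOn
    (f := fun t => t * deriv cutoff t) (continuous_id.mul continuous_deriv_cutoff).continuousOn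
  have hB0 : 0 ≤ B := (norm_nonneg _).trans (hB 0 (by simp))
  refine ⟨B, fun t => ?_⟩
  by_cases ht : t ∈ Icc (0 : ℝ) 2
  · exact hB t ht
  · have : deriv cutoff t = 0 := by
      rcases lt_or_ge t 0 with h | h
      · exact deriv_cutoff_of_lt_one (by linarith)
      · exact deriv_cutoff_of_two_lt (lt_of_not_ge fun h2 => ht ⟨h, h2⟩)
    simpa [this] using hB0

theorem inner_mul_mul_of_norm_eq_one {ν : ℂ} (hν : ‖ν‖ = 1) (a b : ℂ) :
    inner ℝ (ν * a) (ν * b) = inner ℝ a b := by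
  have h : (starRingEnd ℂ) ν * ν = 1 := by simp [Complex.conj_mul', hν]
  rw [Complex.inner, Complex.inner, map_mul]
  congr 1
  linear_combination (starRingEnd ℂ) a * b * h

/-- One component of the divergence of `cutoff (n * ‖w‖ ^ 2) • ⟪w, ∇w⟫`: here `w`, `v` and `b` are
the values of the function and of its first two derivatives in the given direction. -/
noncomputable def cutoffFluxDeriv (n : ℝ) (w v b : ℂ) : ℝ :=
  cutoff (n * ‖w‖ ^ 2) * (inner ℝ w b + ‖v‖ ^ 2) +
    2 * n * deriv cutoff (n * ‖w‖ ^ 2) * inner ℝ w v ^ 2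

theorem hasDerivAt_cutoff_mul_inner (n : ℝ) {u v : ℝ → ℂ} {b : ℂ} {t : ℝ}
    (hu : HasDerivAt u (v t) t) (hv : HasDerivAt v b t) :
    HasDerivAt (fun s => cutoff (n * ‖u s‖ ^ 2) * inner ℝ (u s) (v s))
      (cutoffFluxDeriv n (u t) (v t) b) t := by
  have h1 := hu.norm_sq.const_mul n
  have h2 := (hasDerivAt_cutoff (n * ‖u t‖ ^ 2)).comp t h1
  have h3 := h2.mul (hu.inner ℝ hv)
  refine h3.congr_deriv ?_
  simp only [cutoffFluxDeriv, Function.comp_apply, real_inner_self_eq_norm_sq]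
  ring

/-- The divergence of `cutoff (n * ‖w‖ ^ 2) • ⟪w, ∇w⟫` when `Δw + k ^ 2 * w = 0`. -/
noncomputable def cutoffEnergy (k n : ℝ) (w w₁ w₂ : ℂ) : ℝ :=
  cutoff (n * ‖w‖ ^ 2) * (‖w₁‖ ^ 2 + ‖w₂‖ ^ 2 - k ^ 2 * ‖w‖ ^ 2) +
    2 * n * deriv cutoff (n * ‖w‖ ^ 2) * (inner ℝ w w₁ ^ 2 + inner ℝ w w₂ ^ 2)

theorem cutoffFluxDeriv_add_cutoffFluxDeriv {k : ℝ} (n : ℝ) {w w₁ w₂ w₁₁ w₂₂ : ℂ}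
    (h : w₁₁ + w₂₂ + (k : ℂ) ^ 2 * w = 0) :
    cutoffFluxDeriv n w w₁ w₁₁ + cutoffFluxDeriv n w w₂ w₂₂ = cutoffEnergy k n w w₁ w₂ := by
  have h1 : inner ℝ w w₁₁ + inner ℝ w w₂₂ = -(k ^ 2 * ‖w‖ ^ 2) := by
    have h2 : w₁₁ + w₂₂ = (-(k ^ 2) : ℝ) • w := by
      rw [Complex.real_smul]; push_cast; linear_combination h
    rw [← inner_add_right, h2, real_inner_smul_right, real_inner_self_eq_norm_sq]
    ring
  simp only [cutoffFluxDeriv, cutoffEnergy]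
  linear_combination cutoff (n * ‖w‖ ^ 2) * h1

theorem cutoffEnergy_of_lt_one {k n : ℝ} {w : ℂ} (h : n * ‖w‖ ^ 2 < 1) (w₁ w₂ : ℂ) :
    cutoffEnergy k n w w₁ w₂ = 0 := by
  simp [cutoffEnergy, cutoff_of_le_one h.le, deriv_cutoff_of_lt_one h]

theorem cutoffFluxDeriv_of_lt_one {n : ℝ} {w : ℂ} (h : n * ‖w‖ ^ 2 < 1) (v b : ℂ) :
    cutoffFluxDeriv n w v b = 0 := by
  simp [cutoffFluxDeriv, cutoff_of_le_one h.le, deriv_cutoff_of_lt_one h]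

theorem continuousOn_cutoffFluxDeriv {X : Type*} [TopologicalSpace X] {s : Set X} (n : ℝ)
    {w v b : X → ℂ} (hw : ContinuousOn w s) (hv : ContinuousOn v s) (hb : ContinuousOn b s) :
    ContinuousOn (fun p => cutoffFluxDeriv n (w p) (v p) (b p)) s := by
  have h1 : ContinuousOn (fun p => n * ‖w p‖ ^ 2) s := by fun_prop
  have h2 := contDiff_cutoff.continuous.comp_continuousOn h1
  have h3 := continuous_deriv_cutoff.comp_continuousOn h1
  exact (h2.mul ((hw.inner hb).add (hv.norm.pow 2))).add
    ((h3.const_mul (2 * n)).mul ((hw.inner hv).pow 2))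

theorem continuousOn_cutoffEnergy {X : Type*} [TopologicalSpace X] {s : Set X} (k n : ℝ)
    {w v b : X → ℂ} (hw : ContinuousOn w s) (hv : ContinuousOn v s) (hb : ContinuousOn b s) :
    ContinuousOn (fun p => cutoffEnergy k n (w p) (v p) (b p)) s := by
  have h1 : ContinuousOn (fun p => n * ‖w p‖ ^ 2) s := by fun_prop
  have h2 := contDiff_cutoff.continuous.comp_continuousOn h1
  have h3 := continuous_deriv_cutoff.comp_continuousOn h1
  exact (h2.mul (((hv.norm.pow 2).add (hb.norm.pow 2)).sub ((hw.norm.pow 2).const_mul _))).add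
    ((h3.const_mul (2 * n)).mul (((hw.inner hv).pow 2).add ((hw.inner hb).pow 2)))

theorem abs_cutoffEnergy_le {B : ℝ} (hB : ∀ t, |t * deriv cutoff t| ≤ B) (k n : ℝ) (w w₁ w₂ : ℂ) :
    |cutoffEnergy k n w w₁ w₂| ≤
      (1 + 2 * B) * (‖w₁‖ ^ 2 + ‖w₂‖ ^ 2) + k ^ 2 * ‖w‖ ^ 2 := by
  set E := ‖w₁‖ ^ 2 + ‖w₂‖ ^ 2 with hE
  have hE0 : 0 ≤ E := by positivity
  have hB0 : 0 ≤ B := (abs_nonneg _).trans (hB 0)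
  have hsq (v : ℂ) : inner ℝ w v ^ 2 ≤ ‖w‖ ^ 2 * ‖v‖ ^ 2 := by
    rw [← mul_pow, ← sq_abs]
    gcongr
    exact abs_real_inner_le_norm w v
  have h1 : |cutoff (n * ‖w‖ ^ 2) * (E - k ^ 2 * ‖w‖ ^ 2)| ≤ E + k ^ 2 * ‖w‖ ^ 2 := by
    rw [abs_mul, ← one_mul (E + _)]
    refine mul_le_mul (abs_cutoff_le_one _) ?_ (abs_nonneg _) zero_le_one
    rw [abs_le]
    have : 0 ≤ k ^ 2 * ‖w‖ ^ 2 := by positivity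
    constructor <;> linarith
  have h2 : |2 * n * deriv cutoff (n * ‖w‖ ^ 2) * (inner ℝ w w₁ ^ 2 + inner ℝ w w₂ ^ 2)|
      ≤ 2 * B * E := by
    have h3 : inner ℝ w w₁ ^ 2 + inner ℝ w w₂ ^ 2 ≤ ‖w‖ ^ 2 * E := by
      rw [hE]; linarith [hsq w₁, hsq w₂]
    calc _ = |2 * n * deriv cutoff (n * ‖w‖ ^ 2)| * (inner ℝ w w₁ ^ 2 + inner ℝ w w₂ ^ 2) := by
          rw [abs_mul, abs_of_nonneg (add_nonneg (sq_nonneg (inner ℝ w w₁)) (sq_nonneg _))]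
      _ ≤ |2 * n * deriv cutoff (n * ‖w‖ ^ 2)| * (‖w‖ ^ 2 * E) := by gcongr
      _ = 2 * |n * ‖w‖ ^ 2 * deriv cutoff (n * ‖w‖ ^ 2)| * E := by
          simp only [abs_mul, abs_pow, abs_norm, abs_two]; ring
      _ ≤ 2 * B * E := by gcongr; exact hB _
  exact (abs_add_le _ _).trans (by linarith)

theorem tendsto_cutoffEnergy (k : ℝ) {w w₁ w₂ : ℂ} (h₁ : w = 0 → w₁ = 0) (h₂ : w = 0 → w₂ = 0) :
    Tendsto (fun n : ℕ => cutoffEnergy k n w w₁ w₂) atTop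
      (𝓝 (‖w₁‖ ^ 2 + ‖w₂‖ ^ 2 - k ^ 2 * ‖w‖ ^ 2)) := by
  by_cases hw : w = 0
  · simp [cutoffEnergy, hw, h₁ hw, h₂ hw]
  · have hpos : 0 < ‖w‖ ^ 2 := by positivity
    refine tendsto_const_nhds.congr' ?_
    filter_upwards [(tendsto_natCast_atTop_atTop.atTop_mul_const hpos).eventually_gt_atTop (2 : ℝ)]
      with n hn
    simp [cutoffEnergy, cutoff_of_two_le hn.le, deriv_cutoff_of_two_lt hn]

theorem measurableSet_periodCell (L : ℝ) {f : ℝ → ℝ} (hf : Continuous f) :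
    MeasurableSet {p : ℝ × ℝ | 0 ≤ p.1 ∧ p.1 ≤ L ∧ f p.1 ≤ p.2} :=
  (measurableSet_le measurable_const measurable_fst).inter
    ((measurableSet_le measurable_fst measurable_const).inter
      (measurableSet_le (hf.measurable.comp measurable_fst) measurable_snd))

theorem integral_cutoffEnergy_eq_zero {L k : ℝ} (hL : 0 < L) {ν : ℂ} (hν : ‖ν‖ = 1)
    {f : ℝ → ℝ} (hf : Continuous f) (hper : ∀ x, f (x + L) = f x) (hpos : ∀ x, 0 ≤ f x)
    {w w₁ w₂ w₁₁ w₂₂ : ℝ × ℝ → ℂ}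
    (hw : ContinuousOn w {p | f p.1 ≤ p.2})
    (hw₁ : ContinuousOn w₁ {p | f p.1 ≤ p.2}) (hw₂ : ContinuousOn w₂ {p | f p.1 ≤ p.2})
    (hd₁ : ∀ p : ℝ × ℝ, f p.1 ≤ p.2 → HasDerivAt (fun t => w (t, p.2)) (w₁ p) p.1)
    (hd₂ : ∀ p : ℝ × ℝ, f p.1 ≤ p.2 → HasDerivAt (fun t => w (p.1, t)) (w₂ p) p.2)
    (hd₁₁ : ∀ p : ℝ × ℝ, f p.1 < p.2 → HasDerivAt (fun t => w₁ (t, p.2)) (w₁₁ p) p.1)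
    (hd₂₂ : ∀ p : ℝ × ℝ, f p.1 < p.2 → HasDerivAt (fun t => w₂ (p.1, t)) (w₂₂ p) p.2)
    (hw₁₁ : ContinuousOn w₁₁ {p | f p.1 < p.2}) (hw₂₂ : ContinuousOn w₂₂ {p | f p.1 < p.2})
    (helm : ∀ p : ℝ × ℝ, f p.1 < p.2 → w₁₁ p + w₂₂ p + (k : ℂ) ^ 2 * w p = 0)
    (hdir : ∀ x, w (x, f x) = 0)
    (hqp : ∀ p : ℝ × ℝ, f p.1 ≤ p.2 → w (p.1 + L, p.2) = ν * w p)
    (hqp₁ : ∀ p : ℝ × ℝ, f p.1 ≤ p.2 → w₁ (p.1 + L, p.2) = ν * w₁ p)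
    {n R : ℝ} (hR : ∀ p : ℝ × ℝ, f p.1 ≤ p.2 → R ≤ p.2 → n * ‖w p‖ ^ 2 < 1) :
    ∫ p in {p : ℝ × ℝ | 0 ≤ p.1 ∧ p.1 ≤ L ∧ f p.1 ≤ p.2},
      cutoffEnergy k n (w p) (w₁ p) (w₂ p) = 0 := by
  set D : Set (ℝ × ℝ) := {p | f p.1 < p.2} with hD
  have hDo : IsOpen D := isOpen_lt (by fun_prop) (by fun_prop)
  have hDc : IsClosed {p : ℝ × ℝ | f p.1 ≤ p.2} := isClosed_le (by fun_prop) (by fun_prop)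
  have hsub : D ⊆ {p : ℝ × ℝ | f p.1 ≤ p.2} := fun p (hp : f p.1 < p.2) => hp.le
  have hsmall : ∀ p ∉ D, ∀ᶠ q in 𝓝 p, q ∈ D → n * ‖w q‖ ^ 2 < 1 := by
    intro p hp
    by_cases hpc : f p.1 ≤ p.2
    · have hp0 : w p = 0 := by
        have : p = (p.1, f p.1) := Prod.ext rfl (le_antisymm (not_lt.1 hp) hpc)
        rw [this]; exact hdir _
      have hc : ContinuousWithinAt (fun q => n * ‖w q‖ ^ 2) {p : ℝ × ℝ | f p.1 ≤ p.2} p :=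
        (((hw p hpc).norm.pow 2).const_mul n)
      have h1 : n * ‖w p‖ ^ 2 < 1 := by simp [hp0]
      have := hc.eventually (gt_mem_nhds h1)
      filter_upwards [eventually_nhdsWithin_iff.1 this] with q hq hqD using hq (hsub hqD)
    · filter_upwards [hDc.isOpen_compl.mem_nhds hpc] with q hq hqD using absurd (hsub hqD) hq
  have hflux (v : ℝ × ℝ → ℂ) : ∀ p ∉ D, ∀ᶠ q in 𝓝 p, q ∈ D →
      cutoff (n * ‖w q‖ ^ 2) * inner ℝ (w q) (v q) = 0 := by
    intro p hp
    filter_upwards [hsmall p hp] with q hq hqD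
    simp [cutoff_of_le_one (hq hqD).le]
  have hdiv (v b : ℝ × ℝ → ℂ) : ∀ p ∉ D, ∀ᶠ q in 𝓝 p, q ∈ D →
      cutoffFluxDeriv n (w q) (v q) (b q) = 0 := by
    intro p hp
    filter_upwards [hsmall p hp] with q hq hqD using cutoffFluxDeriv_of_lt_one (hq hqD) _ _
  let F (v : ℝ × ℝ → ℂ) : ℝ × ℝ → ℝ :=
    D.indicator fun p => cutoff (n * ‖w p‖ ^ 2) * inner ℝ (w p) (v p)
  let F' (v b : ℝ × ℝ → ℂ) : ℝ × ℝ → ℝ :=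
    D.indicator fun p => cutoffFluxDeriv n (w p) (v p) (b p)
  have hF'0 (v b : ℝ × ℝ → ℂ) {p : ℝ × ℝ} (hp : p ∈ D → n * ‖w p‖ ^ 2 < 1) : F' v b p = 0 :=
    indicator_apply_eq_zero.2 fun h => cutoffFluxDeriv_of_lt_one (hp h) _ _
  have hF0 (v : ℝ × ℝ → ℂ) {p : ℝ × ℝ} (hp : p ∈ D → n * ‖w p‖ ^ 2 < 1) : F v p = 0 :=
    indicator_apply_eq_zero.2 fun h => by simp [cutoff_of_le_one (hp h).le]
  have hlow {x y : ℝ} (hy : y < 0) : (x, y) ∉ D := fun h =>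
    absurd ((hpos x).trans_lt h) hy.not_gt
  have hrect : ∫ p in Icc 0 L ×ˢ Icc (-1) (max R 0), (F' w₁ w₁₁ p + F' w₂ w₂₂ p) = 0 := by
    refine integral_divergence_rectangle_eq_zero (F := F w₁) (G := F w₂) hL.le
      (by linarith [le_max_right R 0]) ?_ ?_ ?_ ?_ ?_ ?_
    · exact continuous_indicator_of_eventually_zero hDo (continuousOn_cutoffFluxDeriv n
        (hw.mono hsub) (hw₁.mono hsub) hw₁₁) (hdiv _ _)
    · exact continuous_indicator_of_eventually_zero hDo (continuousOn_cutoffFluxDeriv n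
        (hw.mono hsub) (hw₂.mono hsub) hw₂₂) (hdiv _ _)
    · intro x y
      exact hasDerivAt_indicator_comp (c := fun t => (t, y)) hDo (by fun_prop) x
        (fun h => hasDerivAt_cutoff_mul_inner n (u := fun t => w (t, y)) (v := fun t => w₁ (t, y))
          (hd₁ _ (hsub h)) (hd₁₁ _ h)) (hflux _)
    · intro x y
      exact hasDerivAt_indicator_comp (c := fun t => (x, t)) hDo (by fun_prop) y
        (fun h => hasDerivAt_cutoff_mul_inner n (u := fun t => w (x, t)) (v := fun t => w₂ (x, t))
          (hd₂ _ (hsub h)) (hd₂₂ _ h)) (hflux _)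
    · intro y
      have hiff : (0, y) ∈ D ↔ (L, y) ∈ D := by
        have := hper 0
        rw [zero_add] at this
        simp [hD, this]
      by_cases h0 : (0, y) ∈ D
      · have e := hqp (0, y) (hsub h0)
        have e₁ := hqp₁ (0, y) (hsub h0)
        simp only [zero_add] at e e₁
        simp only [F, indicator_of_mem h0, indicator_of_mem (hiff.1 h0), e, e₁,
          inner_mul_mul_of_norm_eq_one hν, norm_mul, hν, one_mul]
      · simp only [F, indicator_of_notMem h0, indicator_of_notMem (fun h => h0 (hiff.2 h))]
    · intro x
      rw [hF0 w₂ (fun h => absurd h (hlow (by norm_num))),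
        hF0 w₂ (fun h => hR _ (hsub h) (le_max_left R 0))]
  have hEq : ∀ p ∈ {p : ℝ × ℝ | 0 ≤ p.1 ∧ p.1 ≤ L ∧ f p.1 ≤ p.2},
      cutoffEnergy k n (w p) (w₁ p) (w₂ p) = F' w₁ w₁₁ p + F' w₂ w₂₂ p := by
    rintro p ⟨-, -, hp⟩
    by_cases hpD : p ∈ D
    · simp only [F', indicator_of_mem hpD]
      exact (cutoffFluxDeriv_add_cutoffFluxDeriv n (helm p hpD)).symm
    · have hp0 : w p = 0 := by
        have : p = (p.1, f p.1) := Prod.ext rfl (le_antisymm (not_lt.1 hpD) hp)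
        rw [this]; exact hdir _
      rw [cutoffEnergy_of_lt_one (by simp [hp0]), hF'0 _ _ fun h => absurd h hpD,
        hF'0 _ _ fun h => absurd h hpD, add_zero]
  have hDL := measurableSet_periodCell L hf
  have hstrip : MeasurableSet (Icc 0 L ×ˢ (univ : Set ℝ)) := measurableSet_Icc.prod .univ
  rw [setIntegral_congr_fun hDL hEq]
  refine Eq.trans ?_ hrect
  rw [← setIntegral_eq_of_subset_of_forall_sdiff_eq_zero hstrip
      (s := Icc 0 L ×ˢ Icc (-1) (max R 0)),
    ← setIntegral_eq_of_subset_of_forall_sdiff_eq_zero hstrip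
      (s := {p : ℝ × ℝ | 0 ≤ p.1 ∧ p.1 ≤ L ∧ f p.1 ≤ p.2})]
  · exact fun p hp => ⟨⟨hp.1, hp.2.1⟩, mem_univ _⟩
  · rintro p ⟨hp, hp'⟩
    have hpD : p ∉ D := fun h => hp' ⟨hp.1.1, hp.1.2, hsub h⟩
    rw [hF'0 _ _ fun h => absurd h hpD, hF'0 _ _ fun h => absurd h hpD, add_zero]
  · exact prod_mono_right (subset_univ _)
  · rintro p ⟨hp, hp'⟩
    have hp1 : p ∈ D → n * ‖w p‖ ^ 2 < 1 := by
      intro h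
      refine hR p (hsub h) (le_of_not_gt fun hlt => hp' ⟨hp.1, ?_, ?_⟩)
      · have := hpos p.1
        have h' : f p.1 < p.2 := h
        linarith
      · exact hlt.le.trans (le_max_left _ _)
    rw [hF'0 _ _ hp1, hF'0 _ _ hp1, add_zero]

theorem integrableOn_norm_sq_of_exp_decay {L C γ : ℝ} (hγ : 0 < γ) {f : ℝ → ℝ}
    (hf : Continuous f) (hpos : ∀ x, 0 ≤ f x) {u : ℝ × ℝ → ℂ}
    (hu : ContinuousOn u {p | f p.1 ≤ p.2})
    (hdecay : ∀ p : ℝ × ℝ, f p.1 ≤ p.2 → ‖u p‖ ≤ C * Real.exp (-γ * p.2)) :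
    IntegrableOn (fun p => ‖u p‖ ^ 2) {p : ℝ × ℝ | 0 ≤ p.1 ∧ p.1 ≤ L ∧ f p.1 ≤ p.2} := by
  have hDL := measurableSet_periodCell L hf
  have hexp : IntegrableOn (fun y : ℝ => Real.exp (-(2 * γ) * y)) (Ici 0) :=
    (integrableOn_Ici_iff_integrableOn_Ioi (by simp)).2 (exp_neg_integrableOn_Ioi 0 (by positivity))
  have hone : IntegrableOn (fun _ : ℝ => C ^ 2) (Icc 0 L) :=
    continuousOn_const.integrableOn_compact isCompact_Icc
  have hdom : IntegrableOn (fun p : ℝ × ℝ => C ^ 2 * Real.exp (-(2 * γ) * p.2))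
      (Icc 0 L ×ˢ Ici 0) := by
    rw [IntegrableOn, Measure.volume_eq_prod, ← Measure.prod_restrict]
    exact Integrable.mul_prod hone hexp
  refine Integrable.mono' (hdom.mono_set
      fun p hp => ⟨⟨hp.1, hp.2.1⟩, (hpos p.1).trans hp.2.2⟩) ?_ ?_
  · exact ((hu.mono fun p hp => hp.2.2).norm.pow 2).aestronglyMeasurable hDL
  · refine ae_restrict_of_forall_mem hDL fun p hp => ?_
    rw [Real.norm_of_nonneg (by positivity)]
    calc ‖u p‖ ^ 2 ≤ (C * Real.exp (-γ * p.2)) ^ 2 := by gcongr; exact hdecay p hp.2.2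
      _ = C ^ 2 * Real.exp (-(2 * γ) * p.2) := by
        rw [mul_pow, ← Real.exp_nat_mul]; congr 2; push_cast; ring

/- STATEMENT 7:
Context: L > 0, k > 0, θ ∈ (0,π/2), ν = e^{ikL cos θ}; f : ℝ → ℝ Lipschitz, L-periodic,
nonnegative; D = {(x,y) : y > f(x)} (closure Dbar = {y ≥ f(x)} since f is continuous),
S = graph of f, D_L = {(x,y) : 0 ≤ x ≤ L, y ≥ f(x)};
w quasiperiodic means w(x+L,y) = ν w(x,y) and ∂ₓw(x+L,y) = ν ∂ₓw(x,y).
Suppose w is continuous on Dbar, continuously differentiable up to the boundary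
(partials w1 = ∂ₓw, w2 = ∂_y w exist on Dbar and are continuous there), twice continuously
differentiable in D (second partials w11, w22 on D, continuous there), quasiperiodic,
Δw + k²w = 0 in D, w = 0 on S, and |w| + |∇w| ≤ C e^{−γy} on Dbar for some C, γ > 0.
Then ∫_{D_L}|∇w|² and ∫_{D_L}|w|² are finite and ∫_{D_L}|∇w|² = k²∫_{D_L}|w|². -/
theorem statement7
    (L k θ : ℝ) (hL : 0 < L) (hk : 0 < k) (hθ : θ ∈ Set.Ioo 0 (Real.pi / 2))
    (ν : ℂ) (hν : ν = Complex.exp (Complex.I * k * L * Real.cos θ))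
    (f : ℝ → ℝ) (hlip : ∃ K : NNReal, LipschitzWith K f)
    (hper : ∀ x : ℝ, f (x + L) = f x) (hpos : ∀ x : ℝ, 0 ≤ f x)
    (D Dbar DL : Set (ℝ × ℝ))
    (hD : D = {p : ℝ × ℝ | f p.1 < p.2})
    (hDbar : Dbar = {p : ℝ × ℝ | f p.1 ≤ p.2})
    (hDL : DL = {p : ℝ × ℝ | 0 ≤ p.1 ∧ p.1 ≤ L ∧ f p.1 ≤ p.2})
    (w w1 w2 w11 w22 : ℝ × ℝ → ℂ)
    (hcontw : ContinuousOn w Dbar)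
    (hcontw1 : ContinuousOn w1 Dbar) (hcontw2 : ContinuousOn w2 Dbar)
    (hd1 : ∀ p ∈ Dbar, HasDerivAt (fun t => w (t, p.2)) (w1 p) p.1)
    (hd2 : ∀ p ∈ Dbar, HasDerivAt (fun t => w (p.1, t)) (w2 p) p.2)
    (hd11 : ∀ p ∈ D, HasDerivAt (fun t => w1 (t, p.2)) (w11 p) p.1)
    (hd22 : ∀ p ∈ D, HasDerivAt (fun t => w2 (p.1, t)) (w22 p) p.2)
    (hcontw11 : ContinuousOn w11 D) (hcontw22 : ContinuousOn w22 D)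
    (helm : ∀ p ∈ D, w11 p + w22 p + (k : ℂ) ^ 2 * w p = 0)
    (hdir : ∀ x : ℝ, w (x, f x) = 0)
    (hqp : ∀ p ∈ Dbar, w (p.1 + L, p.2) = ν * w p)
    (hqp1 : ∀ p ∈ Dbar, w1 (p.1 + L, p.2) = ν * w1 p)
    (C γ : ℝ) (hC : 0 < C) (hγ : 0 < γ)
    (hdecay : ∀ p ∈ Dbar, ‖w p‖ + ‖w1 p‖ + ‖w2 p‖ ≤ C * Real.exp (-γ * p.2)) :
    IntegrableOn (fun p : ℝ × ℝ => ‖w1 p‖ ^ 2 + ‖w2 p‖ ^ 2) DL volume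
    ∧ IntegrableOn (fun p : ℝ × ℝ => ‖w p‖ ^ 2) DL volume
    ∧ (∫ p in DL, (‖w1 p‖ ^ 2 + ‖w2 p‖ ^ 2)) = k ^ 2 * ∫ p in DL, ‖w p‖ ^ 2 := by
  obtain ⟨K, hK⟩ := hlip
  have hf : Continuous f := hK.continuous
  subst hD hDbar hDL
  have hν1 : ‖ν‖ = 1 := by
    rw [hν, show Complex.I * k * L * Real.cos θ = ((k * L * Real.cos θ : ℝ) : ℂ) * Complex.I by
      push_cast; ring]
    exact Complex.norm_exp_ofReal_mul_I _
  have hb (p : ℝ × ℝ) (hp : f p.1 ≤ p.2) := hdecay p hp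
  have hI : IntegrableOn (fun p => ‖w p‖ ^ 2) {p : ℝ × ℝ | 0 ≤ p.1 ∧ p.1 ≤ L ∧ f p.1 ≤ p.2} :=
    integrableOn_norm_sq_of_exp_decay (C := C) hγ hf hpos hcontw fun p hp => by
      linarith [hb p hp, norm_nonneg (w1 p), norm_nonneg (w2 p)]
  have hI1 : IntegrableOn (fun p => ‖w1 p‖ ^ 2) {p : ℝ × ℝ | 0 ≤ p.1 ∧ p.1 ≤ L ∧ f p.1 ≤ p.2} :=
    integrableOn_norm_sq_of_exp_decay (C := C) hγ hf hpos hcontw1 fun p hp => by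
      linarith [hb p hp, norm_nonneg (w p), norm_nonneg (w2 p)]
  have hI2 : IntegrableOn (fun p => ‖w2 p‖ ^ 2) {p : ℝ × ℝ | 0 ≤ p.1 ∧ p.1 ≤ L ∧ f p.1 ≤ p.2} :=
    integrableOn_norm_sq_of_exp_decay (C := C) hγ hf hpos hcontw2 fun p hp => by
      linarith [hb p hp, norm_nonneg (w p), norm_nonneg (w1 p)]
  have hIgrad : IntegrableOn (fun p => ‖w1 p‖ ^ 2 + ‖w2 p‖ ^ 2)
      {p : ℝ × ℝ | 0 ≤ p.1 ∧ p.1 ≤ L ∧ f p.1 ≤ p.2} := hI1.add hI2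
  refine ⟨hIgrad, hI, ?_⟩
  have hDc : IsClosed {p : ℝ × ℝ | f p.1 ≤ p.2} := isClosed_le (by fun_prop) (by fun_prop)
  have hDLm := measurableSet_periodCell L hf
  have hDLsub : {p : ℝ × ℝ | 0 ≤ p.1 ∧ p.1 ≤ L ∧ f p.1 ≤ p.2} ⊆ {p : ℝ × ℝ | f p.1 ≤ p.2} :=
    fun p hp => hp.2.2
  have hzero (n : ℕ) : ∫ p in {p : ℝ × ℝ | 0 ≤ p.1 ∧ p.1 ≤ L ∧ f p.1 ≤ p.2},
      cutoffEnergy k n (w p) (w1 p) (w2 p) = 0 := by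
    have hlim : Tendsto (fun y : ℝ => n * (C * Real.exp (-γ * y)) ^ 2) atTop (𝓝 0) := by
      have h1 : Tendsto (fun y : ℝ => Real.exp (-γ * y)) atTop (𝓝 0) :=
        Real.tendsto_exp_atBot.comp (tendsto_id.const_mul_atTop_of_neg (neg_neg_iff_pos.2 hγ))
      simpa using ((h1.const_mul C).pow 2).const_mul (n : ℝ)
    obtain ⟨R, hR⟩ := eventually_atTop.1 (hlim.eventually (gt_mem_nhds zero_lt_one))
    refine integral_cutoffEnergy_eq_zero hL hν1 hf hper hpos hcontw hcontw1 hcontw2 hd1 hd2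
      hd11 hd22 hcontw11 hcontw22 helm hdir hqp hqp1 (R := R) fun p hp hpR => ?_
    refine lt_of_le_of_lt ?_ (hR p.2 hpR)
    gcongr
    linarith [hb p hp, norm_nonneg (w1 p), norm_nonneg (w2 p)]
  obtain ⟨B, hB⟩ := exists_abs_mul_deriv_cutoff_le
  have hnull1 := volume_eq_zero_and_deriv_fst_ne_zero hDc hcontw hcontw1 hd1
  have hnull2 := volume_eq_zero_and_deriv_snd_ne_zero hDc hcontw hcontw2 hd2
  have hlim := tendsto_integral_of_dominated_convergence
    (μ := volume.restrict {p : ℝ × ℝ | 0 ≤ p.1 ∧ p.1 ≤ L ∧ f p.1 ≤ p.2})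
    (F := fun (n : ℕ) p => cutoffEnergy k n (w p) (w1 p) (w2 p))
    (f := fun p => ‖w1 p‖ ^ 2 + ‖w2 p‖ ^ 2 - k ^ 2 * ‖w p‖ ^ 2)
    (fun p => (1 + 2 * B) * (‖w1 p‖ ^ 2 + ‖w2 p‖ ^ 2) + k ^ 2 * ‖w p‖ ^ 2)
    (fun n => (continuousOn_cutoffEnergy k n (hcontw.mono hDLsub) (hcontw1.mono hDLsub)
      (hcontw2.mono hDLsub)).aestronglyMeasurable hDLm)
    ((hIgrad.const_mul _).add (hI.const_mul _))
    (fun n => Eventually.of_forall fun p => abs_cutoffEnergy_le hB k n _ _ _)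
    (by
      filter_upwards [ae_restrict_mem hDLm,
        ae_restrict_of_ae (measure_eq_zero_iff_ae_notMem.1 hnull1),
        ae_restrict_of_ae (measure_eq_zero_iff_ae_notMem.1 hnull2)] with p hp h1 h2
      exact tendsto_cutoffEnergy k
        (fun h => by_contra fun h' => h1 ⟨hp.2.2, h, h'⟩)
        (fun h => by_contra fun h' => h2 ⟨hp.2.2, h, h'⟩))
  simp only [hzero] at hlim
  have hfinal := tendsto_nhds_unique hlim tendsto_const_nhds
  rw [integral_sub hIgrad (hI.const_mul _), integral_const_mul] at hfinal
  exact sub_eq_zero.1 hfinal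
end

section
/- Uniqueness for the quasiperiodic Dirichlet problem (Lemma 2.2). Suppose w is continuous on the closure of D, continuously differentiable up to the boundary, twice continuously differentiable in D, satisfies Δw + k²w = 0 in D, w = 0 on S, is quasiperiodic, and ∫_{D_L} |w(x,y)|² dx dy < ∞. Then w ≡ 0 in D. -/
open MeasureTheory

section

open Set Filter Topology intervalIntegral Asymptotics
open scoped InnerProductSpace ComplexConjugate

/-- First-order expansion of the integral of `F` over the fibre above a Lipschitz graph. -/
theorem isLittleO_integral_above_graph {E : Type*} [NormedAddCommGroup E] [NormedSpace ℝ E]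
    [CompleteSpace E] {f : ℝ → ℝ} {K : NNReal} (hf : LipschitzWith K f) {F R : ℝ × ℝ → E}
    (hF : Continuous F) (hR : Continuous R) {x₀ h : ℝ} (hh : f x₀ < h)
    (hrect : ∀ x a, (∀ ξ ∈ uIcc x₀ x, f ξ < a) → a ≤ h →
      ∫ t in a..h, (F (x, t) - F (x₀, t)) = ∫ ξ in x₀..x, R (ξ, a)) :
    (fun x => (∫ t in f x..h, F (x, t)) - (∫ t in f x₀..h, F (x₀, t))
      + (f x - f x₀) • F (x₀, f x₀) - (x - x₀) • R (x₀, f x₀)) =o[𝓝 x₀] fun x => x - x₀ := by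
  set P := F (x₀, f x₀)
  set R₀ := R (x₀, f x₀)
  refine isLittleO_iff.2 fun c hc => ?_
  have hK : (0 : ℝ) ≤ K := K.2
  set c' : ℝ := c / (3 * K + 3)
  have hc' : 0 < c' := by positivity
  obtain ⟨ρ₁, hρ₁, h₁⟩ := Metric.continuousAt_iff.1 (hF.continuousAt (x := (x₀, f x₀))) c' hc'
  obtain ⟨ρ₂, hρ₂, h₂⟩ := Metric.continuousAt_iff.1 (hR.continuousAt (x := (x₀, f x₀))) c' hc'
  set r : ℝ := min (min ρ₁ ρ₂) (h - f x₀) / (K + 2)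
  have hr : 0 < r := by
    have : 0 < h - f x₀ := by linarith
    positivity
  have hrle : (K + 2) * r = min (min ρ₁ ρ₂) (h - f x₀) := by
    simp only [r]; field_simp
  filter_upwards [Metric.ball_mem_nhds x₀ hr] with x hx
  rw [Metric.mem_ball, Real.dist_eq] at hx
  rcases eq_or_ne x x₀ with rfl | hne
  · simp
  have hδ : 0 < |x - x₀| := abs_pos.2 (sub_ne_zero.2 hne)
  set δ := |x - x₀|
  have hlip : ∀ ξ ∈ uIcc x₀ x, |f ξ - f x₀| ≤ K * δ ∧ |ξ - x₀| ≤ δ := by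
    intro ξ hξ
    have h1 : |ξ - x₀| ≤ δ := abs_sub_left_of_mem_uIcc hξ
    refine ⟨?_, h1⟩
    have := hf.dist_le_mul ξ x₀
    rw [Real.dist_eq, Real.dist_eq] at this
    exact this.trans (mul_le_mul_of_nonneg_left h1 hK)
  set a := f x₀ + (K + 1) * δ
  have hbig : (K + 2) * δ < min (min ρ₁ ρ₂) (h - f x₀) := by
    rw [← hrle]; exact mul_lt_mul_of_pos_left hx (by positivity)
  have hb1 : (K + 2) * δ < ρ₁ := hbig.trans_le ((min_le_left _ _).trans (min_le_left _ _))
  have hb2 : (K + 2) * δ < ρ₂ := hbig.trans_le ((min_le_left _ _).trans (min_le_right _ _))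
  have hb3 : (K + 2) * δ < h - f x₀ := hbig.trans_le (min_le_right _ _)
  have hKδ : 0 ≤ K * δ := by positivity
  have hah : a ≤ h := by simp only [a]; linarith
  have hfa : ∀ ξ ∈ uIcc x₀ x, f ξ < a := fun ξ hξ => by
    have := abs_le.1 (hlip ξ hξ).1
    simp only [a]; linarith
  have hnear : ∀ y t, |y - x₀| ≤ δ → |t - f x₀| ≤ (K + 1) * δ →
      ‖F (y, t) - P‖ ≤ c' ∧ ‖R (y, t) - R₀‖ ≤ c' := by
    intro y t hy ht
    have hd : dist (y, t) (x₀, f x₀) ≤ (K + 1) * δ := by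
      rw [Prod.dist_eq]
      refine max_le ?_ ht
      rw [Real.dist_eq]; dsimp only; linarith
    rw [← dist_eq_norm, ← dist_eq_norm]
    exact ⟨(h₁ (hd.trans_lt (by linarith))).le, (h₂ (hd.trans_lt (by linarith))).le⟩
  have hfx := abs_le.1 (hlip x right_mem_uIcc).1
  have hFi : ∀ y p q, IntervalIntegrable (fun t => F (y, t)) volume p q := fun y p q =>
    (hF.comp (by fun_prop)).intervalIntegrable _ _
  have hRi : ∀ p q, IntervalIntegrable (fun ξ => R (ξ, a)) volume p q := fun p q =>
    (hR.comp (by fun_prop)).intervalIntegrable _ _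
  have e1 : ‖(∫ t in f x..a, F (x, t)) - (a - f x) • P‖ ≤ c' * ((2 * K + 1) * δ) := by
    rw [← intervalIntegral.integral_const, ← integral_sub (hFi _ _ _) (by simp)]
    refine (intervalIntegral.norm_integral_le_of_norm_le_const (C := c') fun t ht => ?_).trans ?_
    · rw [uIoc_of_le (hfa x right_mem_uIcc).le] at ht
      refine (hnear x t le_rfl ?_).1
      rw [abs_le]; constructor <;> [skip; simp only [a] at ht] <;> linarith [ht.1, ht.2]
    · gcongr
      rw [abs_of_nonneg (by linarith [hfa x right_mem_uIcc])]
      simp only [a]; linarith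
  have e2 : ‖(∫ t in f x₀..a, F (x₀, t)) - (a - f x₀) • P‖ ≤ c' * ((K + 1) * δ) := by
    rw [← intervalIntegral.integral_const, ← integral_sub (hFi _ _ _) (by simp)]
    refine (intervalIntegral.norm_integral_le_of_norm_le_const (C := c') fun t ht => ?_).trans ?_
    · rw [uIoc_of_le (hfa x₀ left_mem_uIcc).le] at ht
      refine (hnear x₀ t (by simpa using hδ.le) ?_).1
      rw [abs_le]; constructor <;> [skip; simp only [a] at ht] <;> linarith [ht.1, ht.2]
    · gcongr
      rw [abs_of_nonneg (by linarith [hfa x₀ left_mem_uIcc])]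
      simp only [a]; linarith
  have e3 : ‖(∫ ξ in x₀..x, R (ξ, a)) - (x - x₀) • R₀‖ ≤ c' * δ := by
    rw [← intervalIntegral.integral_const, ← integral_sub (hRi _ _) (by simp)]
    refine intervalIntegral.norm_integral_le_of_norm_le_const fun ξ hξ => ?_
    refine (hnear ξ a (hlip ξ (uIoc_subset_uIcc hξ)).2 ?_).2
    simp only [a, add_sub_cancel_left]
    rw [abs_of_nonneg (by positivity)]
  have s1 := integral_add_adjacent_intervals (hFi x (f x) a) (hFi x a h)
  have s2 := integral_add_adjacent_intervals (hFi x₀ (f x₀) a) (hFi x₀ a h)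
  have s3 := hrect x a hfa hah
  rw [integral_sub (hFi _ _ _) (hFi _ _ _)] at s3
  have key : (∫ t in f x..h, F (x, t)) - (∫ t in f x₀..h, F (x₀, t))
      + (f x - f x₀) • P - (x - x₀) • R₀
      = ((∫ t in f x..a, F (x, t)) - (a - f x) • P)
        - ((∫ t in f x₀..a, F (x₀, t)) - (a - f x₀) • P)
        + ((∫ ξ in x₀..x, R (ξ, a)) - (x - x₀) • R₀) := by
    rw [← s1, ← s2, ← s3]; module
  rw [key]
  calc _ ≤ c' * ((2 * K + 1) * δ) + c' * ((K + 1) * δ) + c' * δ :=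
        (norm_add_le _ _).trans (add_le_add ((norm_sub_le _ _).trans (add_le_add e1 e2)) e3)
    _ = c * ‖x - x₀‖ := by
        rw [Real.norm_eq_abs]; simp only [c']; field_simp; ring

/-- The divergence theorem on a rectangle, for fields having only the partial derivatives that
occur in the divergence. -/
theorem integral_rect_of_partial_derivs {E : Type*} [NormedAddCommGroup E] [NormedSpace ℝ E]
    [CompleteSpace E] {F G F' G' g : ℝ × ℝ → E} {x₀ x a h : ℝ}
    (hF : ∀ p ∈ uIcc x₀ x ×ˢ uIcc a h, HasDerivAt (fun t => F (t, p.2)) (F' p) p.1)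
    (hG : ∀ p ∈ uIcc x₀ x ×ˢ uIcc a h, HasDerivAt (fun t => G (p.1, t)) (G' p) p.2)
    (hFc : ContinuousOn F' (uIcc x₀ x ×ˢ uIcc a h)) (hGc : ContinuousOn G' (uIcc x₀ x ×ˢ uIcc a h))
    (hg : ∀ p ∈ uIcc x₀ x ×ˢ uIcc a h, F' p + G' p = g p) :
    ∫ t in a..h, (F (x, t) - F (x₀, t))
      = ∫ ξ in x₀..x, ((∫ t in a..h, g (ξ, t)) - G (ξ, h) + G (ξ, a)) := by
  have hFx : ∀ t ∈ uIcc a h, ContinuousOn (fun ξ => F' (ξ, t)) (uIcc x₀ x) := fun t ht =>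
    hFc.comp (by fun_prop) fun ξ hξ => ⟨hξ, ht⟩
  have hGy : ∀ ξ ∈ uIcc x₀ x, ContinuousOn (fun t => G' (ξ, t)) (uIcc a h) := fun ξ hξ =>
    hGc.comp (by fun_prop) fun t ht => ⟨hξ, ht⟩
  have hFy : ∀ ξ ∈ uIcc x₀ x, ContinuousOn (fun t => F' (ξ, t)) (uIcc a h) := fun ξ hξ =>
    hFc.comp (by fun_prop) fun t ht => ⟨hξ, ht⟩
  have e1 : ∫ t in a..h, (F (x, t) - F (x₀, t)) = ∫ t in a..h, ∫ ξ in x₀..x, F' (ξ, t) := by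
    refine integral_congr fun t ht => ?_
    exact (integral_eq_sub_of_hasDerivAt (f := fun ξ => F (ξ, t))
      (fun ξ hξ => hF (ξ, t) ⟨hξ, ht⟩) (hFx t ht).intervalIntegrable).symm
  rw [e1, intervalIntegral_intervalIntegral_swap]
  · refine integral_congr fun ξ hξ => ?_
    have e2 : ∫ t in a..h, G' (ξ, t) = G (ξ, h) - G (ξ, a) :=
      integral_eq_sub_of_hasDerivAt (f := fun t => G (ξ, t))
      (fun t ht => hG (ξ, t) ⟨hξ, ht⟩) (hGy ξ hξ).intervalIntegrable
    have e3 : ∫ t in a..h, g (ξ, t) = ∫ t in a..h, (F' (ξ, t) + G' (ξ, t)) :=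
      integral_congr fun t ht => (hg (ξ, t) ⟨hξ, ht⟩).symm
    rw [e3, integral_add (hFy ξ hξ).intervalIntegrable (hGy ξ hξ).intervalIntegrable, e2]
    abel
  · have hc : IsCompact (uIcc a h ×ˢ uIcc x₀ x) := isCompact_uIcc.prod isCompact_uIcc
    have : ContinuousOn (Function.uncurry fun t ξ => F' (ξ, t)) (uIcc a h ×ˢ uIcc x₀ x) :=
      hFc.comp (f := fun p : ℝ × ℝ => (p.2, p.1)) (by fun_prop) fun p hp => ⟨hp.2, hp.1⟩
    exact (this.integrableOn_compact hc).mono_set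
      (prod_mono uIoc_subset_uIcc uIoc_subset_uIcc)

/-- First-order expansion of the integral of `F` over the fibre above a Lipschitz graph, when
`(F, G)` has divergence `g` above the graph. -/
theorem isLittleO_integral_above_graph_of_div {E : Type*} [NormedAddCommGroup E] [NormedSpace ℝ E]
    [CompleteSpace E] {f : ℝ → ℝ} {K : NNReal} (hf : LipschitzWith K f) {F G F' G' g : ℝ × ℝ → E}
    (hF : Continuous F) (hG : Continuous G) (hg : Continuous g)
    (hFd : ∀ p : ℝ × ℝ, f p.1 < p.2 → HasDerivAt (fun t => F (t, p.2)) (F' p) p.1)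
    (hGd : ∀ p : ℝ × ℝ, f p.1 < p.2 → HasDerivAt (fun t => G (p.1, t)) (G' p) p.2)
    (hFc : ContinuousOn F' {p : ℝ × ℝ | f p.1 < p.2})
    (hGc : ContinuousOn G' {p : ℝ × ℝ | f p.1 < p.2})
    (hdiv : ∀ p : ℝ × ℝ, f p.1 < p.2 → F' p + G' p = g p) {x₀ h : ℝ} (hh : f x₀ < h) :
    (fun x => (∫ t in f x..h, F (x, t)) - (∫ t in f x₀..h, F (x₀, t))
      + (f x - f x₀) • F (x₀, f x₀)
      - (x - x₀) • ((∫ t in f x₀..h, g (x₀, t)) - G (x₀, h) + G (x₀, f x₀)))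
      =o[𝓝 x₀] fun x => x - x₀ := by
  refine isLittleO_integral_above_graph hf hF
    (R := fun p => (∫ t in p.2..h, g (p.1, t)) - G (p.1, h) + G p) ?_ hh fun x a ha hah => ?_
  · have : Continuous fun p : ℝ × ℝ => ∫ t in h..p.2, g (p.1, t) :=
      continuous_parametric_intervalIntegral_of_continuous (f := fun (p : ℝ × ℝ) t => g (p.1, t))
        (by simp only [Function.uncurry_def]; fun_prop) continuous_snd
    simp only [integral_symm h]
    fun_prop
  · have hsub : uIcc x₀ x ×ˢ uIcc a h ⊆ {p : ℝ × ℝ | f p.1 < p.2} := fun p hp =>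
      (ha p.1 hp.1).trans_le (by have := hp.2; rw [uIcc_of_le hah] at this; exact this.1)
    exact integral_rect_of_partial_derivs (fun p hp => hFd p (hsub hp))
      (fun p hp => hGd p (hsub hp)) (hFc.mono hsub) (hGc.mono hsub) fun p hp => hdiv p (hsub hp)

/-- A function which is locally `C`-Lipschitz at each point of an interval is Lipschitz there. -/
theorem lipschitzOnWith_of_eventually_norm_sub_le {E : Type*} [NormedAddCommGroup E]
    {g : ℝ → E} {a b : ℝ} {C : NNReal}
    (h : ∀ x ∈ Icc a b, ∀ᶠ z in 𝓝 x, ‖g z - g x‖ ≤ C * |z - x|) :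
    LipschitzOnWith C g (Icc a b) := by
  have hcont : ContinuousOn g (Icc a b) := fun x hx => by
    refine ContinuousAt.continuousWithinAt ?_
    rw [ContinuousAt, tendsto_iff_norm_sub_tendsto_zero]
    refine squeeze_zero' (Eventually.of_forall fun _ => norm_nonneg _) (h x hx) ?_
    have : Continuous fun z : ℝ => (C : ℝ) * |z - x| := by fun_prop
    simpa using this.tendsto x
  have key : ∀ x ∈ Icc a b, ∀ y ∈ Icc x b, ‖g y - g x‖ ≤ C * (y - x) := by
    intro x hx y hy
    refine le_of_forall_pos_le_add fun ε hε => ?_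
    set η := ε / (y - x + 1)
    have hyx : 0 < y - x + 1 := by linarith [hy.1]
    have hη : 0 < η := by positivity
    have := image_norm_le_of_liminf_right_slope_norm_lt_deriv_boundary
      (f := fun z => g z - g x) (f' := fun _ => (C : ℝ)) (a := x) (b := b)
      (B := fun z => (C + η) * (z - x)) (B' := fun _ => C + η)
      ((hcont.mono (Icc_subset_Icc_left hx.1)).sub continuousOn_const) ?_ (by simp)
      (by fun_prop)
      (fun z _ => by
        simpa using (((hasDerivAt_id z).sub_const x).const_mul ((C : ℝ) + η)).hasDerivWithinAt)
      (fun z _ _ => by linarith) hy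
    · refine this.trans ?_
      have : η * (y - x) ≤ ε := by
        simp only [η]
        rw [div_mul_eq_mul_div, div_le_iff₀ hyx]
        nlinarith
      linarith
    · intro z hz r hr
      refine Eventually.frequently ?_
      filter_upwards [nhdsWithin_le_nhds (h z ⟨hx.1.trans hz.1, hz.2.le⟩), self_mem_nhdsWithin]
        with t ht hzt
      have hzt : z < t := hzt
      refine lt_of_le_of_lt ?_ hr
      rw [slope_def_field, div_le_iff₀ (by linarith)]
      simp only [Function.comp]
      have h1 := norm_sub_norm_le (g t - g x) (g z - g x)
      rw [sub_sub_sub_cancel_right] at h1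
      rw [abs_of_pos (by linarith)] at ht
      linarith
  refine LipschitzOnWith.of_dist_le_mul fun x hx y hy => ?_
  rcases le_total x y with hxy | hxy
  · rw [dist_comm, dist_eq_norm, Real.dist_eq, abs_sub_comm, abs_of_nonneg (by linarith)]
    exact key x hx y ⟨hxy, hy.2⟩
  · rw [dist_eq_norm, Real.dist_eq, abs_of_nonneg (by linarith)]
    exact key y hy x ⟨hxy, hx.2⟩

/-- **Parseval's identity** for the inner product, with quasiperiodic characters. -/
theorem hasSum_inner_quasiFourier {L : ℝ} (hL : 0 < L) (κ : ℝ) {g h : ℝ → ℂ} (hg : Continuous g)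
    (hh : Continuous h) :
    HasSum (fun j : ℤ =>
      ⟪∫ x in (0 : ℝ)..L, g x * Complex.exp (-((κ + 2 * Real.pi * j / L : ℝ) * x * Complex.I)),
        ∫ x in (0 : ℝ)..L, h x * Complex.exp (-((κ + 2 * Real.pi * j / L : ℝ) * x * Complex.I))⟫_ℝ)
      (L * ∫ x in (0 : ℝ)..L, ⟪g x, h x⟫_ℝ) := by
  have hT : Fact (0 < L) := ⟨hL⟩
  set e : ℝ → ℂ := fun x => Complex.exp (-(κ * x * Complex.I))
  have he : Continuous e := by fun_prop
  have hee : ∀ x, conj (e x) * e x = 1 := fun x => by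
    rw [← Complex.exp_conj, ← Complex.exp_add]
    simp
  have hmem : ∀ {u : ℝ → ℂ}, Continuous u →
      MemLp (AddCircle.liftIoc L 0 (fun x => u x * e x)) 2 AddCircle.haarAddCircle := by
    intro u hu
    refine MemLp.haarAddCircle (MemLp.memLp_liftIoc ?_)
    have hc : Continuous fun x => u x * e x := hu.mul he
    obtain ⟨C, hC⟩ := isCompact_Icc.exists_bound_of_continuousOn
      (hc.continuousOn (s := Icc (0 : ℝ) (0 + L)))
    refine MemLp.of_bound hc.aestronglyMeasurable C ?_
    exact (ae_restrict_iff' measurableSet_Ioc).2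
      (Eventually.of_forall fun x hx => hC x (Ioc_subset_Icc_self hx))
  obtain ⟨G, hG⟩ : ∃ G : (u : ℝ → ℂ) → Continuous u → Lp ℂ 2 (@AddCircle.haarAddCircle L hT),
      ∀ u hu, G u hu =ᵐ[AddCircle.haarAddCircle] AddCircle.liftIoc L 0 (fun x => u x * e x) :=
    ⟨fun u hu => (hmem hu).toLp, fun u hu => (hmem hu).coeFn_toLp⟩
  have hcoef : ∀ {u : ℝ → ℂ} (hu : Continuous u) (j : ℤ),
      ∫ x in (0 : ℝ)..L, u x * Complex.exp (-((κ + 2 * Real.pi * j / L : ℝ) * x * Complex.I))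
        = L * (fourierBasis.repr (G u hu) j) := by
    intro u hu j
    rw [fourierBasis_repr, fourierCoeff_congr_ae (hG u hu),
      fourierCoeff_eq_intervalIntegral _ _ 0]
    rw [Complex.real_smul, ← mul_assoc]
    have : (L : ℂ) * ((1 / L : ℝ) : ℂ) = 1 := by
      rw [← Complex.ofReal_mul, mul_one_div_cancel hL.ne', Complex.ofReal_one]
    rw [this, one_mul, zero_add]
    rw [integral_of_le hL.le, integral_of_le hL.le]
    refine setIntegral_congr_fun measurableSet_Ioc fun x hx => ?_
    rw [AddCircle.liftIoc_coe_apply (by simpa using hx), fourier_coe_apply, smul_eq_mul]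
    simp only [e]
    rw [mul_left_comm, ← Complex.exp_add]
    congr 2
    push_cast
    field_simp
    ring
  have hP := fourierBasis.hasSum_inner_mul_inner (G g hg) (G h hh)
  have hre := (Complex.reCLM.hasSum hP).mul_left (L ^ 2)
  have hI : L ^ 2 * Complex.reCLM ⟪G g hg, G h hh⟫_ℂ
      = L * ∫ x in (0 : ℝ)..L, ⟪g x, h x⟫_ℝ := by
    rw [L2.inner_def]
    have e1 : ∫ a : AddCircle L, inner ℂ (G g hg a) (G h hh a)
          ∂AddCircle.haarAddCircle
        = ∫ a : AddCircle L, AddCircle.liftIoc L 0 (fun x => conj (g x) * h x) a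
          ∂AddCircle.haarAddCircle := by
      refine integral_congr_ae ?_
      filter_upwards [hG g hg, hG h hh] with a h1 h2
      rw [h1, h2, RCLike.inner_apply']
      simp only [AddCircle.liftIoc, Function.comp, Set.domRestrict_apply]
      rw [map_mul, mul_mul_mul_comm, hee, mul_one]
    rw [e1, AddCircle.integral_haarAddCircle, AddCircle.integral_liftIoc_eq_intervalIntegral,
      zero_add]
    have e2 : Complex.reCLM (∫ x in (0 : ℝ)..L, conj (g x) * h x)
        = ∫ x in (0 : ℝ)..L, ⟪g x, h x⟫_ℝ := by
      rw [← ContinuousLinearMap.intervalIntegral_comp_comm]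
      · simp [Complex.inner, mul_comm]
      · exact (by fun_prop : Continuous fun x => conj (g x) * h x).intervalIntegrable _ _
    rw [map_smul, e2, smul_eq_mul]
    field_simp
  rw [← hI]
  convert! hre using 2 with j
  rw [hcoef hg, hcoef hh, HilbertBasis.repr_apply_apply, HilbertBasis.repr_apply_apply,
    ← inner_conj_symm (𝕜 := ℂ) (G g hg)]
  simp only [Complex.inner, Complex.reCLM_apply, map_mul, Complex.conj_ofReal]
  rw [show ∀ a b : ℂ, (L : ℂ) * a * (L * b) = ((L ^ 2 : ℝ) : ℂ) * (a * b) by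
    intro a b; push_cast; ring, Complex.re_ofReal_mul, mul_comm (conj _)]

/-- A square-integrable solution of `u'' = μ u` on a half-line satisfies `u' = r u`
for a real constant `r`. -/
theorem exists_real_smul_of_integrableOn {u v : ℝ → ℂ} {c μ : ℝ} (hμ : μ ≠ 0)
    (hu : ∀ y, c < y → HasDerivAt u (v y) y) (hv : ∀ y, c < y → HasDerivAt v (μ * u y) y)
    (hint : IntegrableOn (fun y => ‖u y‖ ^ 2) (Ioi c)) :
    ∃ r : ℝ, ∀ y, c < y → v y = r * u y := by
  set b := c + 1
  have hcb : c < b := by simp [b]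
  have hbint : IntegrableOn (fun y => ‖u y‖ ^ 2) (Ioi b) :=
    hint.mono_set (Ioi_subset_Ioi hcb.le)
  have hI : ∀ y, c < y → HasDerivAt (fun y => ‖u y‖ ^ 2) (2 * ⟪u y, v y⟫_ℝ) y := fun y hy =>
    (hu y hy).norm_sq
  have hE : ∀ y, c < y → HasDerivAt (fun y => ‖v y‖ ^ 2 - μ * ‖u y‖ ^ 2) 0 y := fun y hy => by
    have h1 := (hv y hy).norm_sq.sub ((hI y hy).const_mul μ)
    convert! h1 using 1
    rw [real_inner_comm, ← Complex.real_smul, real_inner_smul_left]; ring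
  obtain ⟨E, hEc⟩ : ∃ E, ∀ y, c < y → ‖v y‖ ^ 2 - μ * ‖u y‖ ^ 2 = E := by
    refine ⟨‖v b‖ ^ 2 - μ * ‖u b‖ ^ 2, fun y hy => ?_⟩
    exact isOpen_Ioi.is_const_of_deriv_eq_zero isPreconnected_Ioi
      (fun z hz => (hE z hz).differentiableAt.differentiableWithinAt)
      (fun z hz => (hE z hz).deriv) hy hcb
  have hJ : ∀ y, c < y → HasDerivAt (fun y => ⟪u y, v y⟫_ℝ) (E + 2 * μ * ‖u y‖ ^ 2) y := by
    intro y hy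
    have := (hu y hy).inner ℝ (hv y hy)
    convert! this using 1
    rw [← Complex.real_smul, real_inner_smul_right, real_inner_self_eq_norm_sq,
      real_inner_self_eq_norm_sq, ← hEc y hy]
    ring
  have hnotbig : ∀ d : ℝ, c < d → ¬ ∀ y, d < y → 1 ≤ ‖u y‖ ^ 2 := by
    intro d hd h
    have h1 : IntegrableOn (fun _ : ℝ => (1 : ℝ)) (Ioi d) := by
      refine Integrable.mono' (hint.mono_set (Ioi_subset_Ioi hd.le)) (by fun_prop) ?_
      refine (ae_restrict_iff' measurableSet_Ioi).2 (Eventually.of_forall fun y hy => ?_)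
      simpa using h y hy
    rw [integrableOn_const_iff] at h1
    simp at h1
  have hcontI : ContinuousOn (fun y => ‖u y‖ ^ 2) (Ioi c) := fun y hy =>
    (hI y hy).continuousAt.continuousWithinAt
  set A := ∫ y in Ioi b, ‖u y‖ ^ 2
  have hJform : ∀ y, b ≤ y → |⟪u y, v y⟫_ℝ - ⟪u b, v b⟫_ℝ - E * (y - b)| ≤ 2 * |μ| * A := by
    intro y hy
    have hsub : uIcc b y ⊆ Ioi c := by
      rw [uIcc_of_le hy]; exact fun z hz => hcb.trans_le hz.1
    have h1 := integral_eq_sub_of_hasDerivAt (fun z hz => hJ z (hsub hz))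
      (ContinuousOn.intervalIntegrable
        (continuousOn_const.add (continuousOn_const.mul (hcontI.mono hsub))))
    rw [integral_add (by simp) ((hcontI.mono hsub).intervalIntegrable.const_mul _),
      intervalIntegral.integral_const, intervalIntegral.integral_const_mul, smul_eq_mul] at h1
    have h2 : ⟪u y, v y⟫_ℝ - ⟪u b, v b⟫_ℝ - E * (y - b) = 2 * μ * ∫ z in b..y, ‖u z‖ ^ 2 := by
      rw [← h1]; ring
    have h3 : ∫ z in b..y, ‖u z‖ ^ 2 ≤ A := by
      rw [integral_of_le hy]
      exact setIntegral_mono_set hbint (Eventually.of_forall fun _ => by positivity)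
        (Ioc_subset_Ioi_self.eventuallyLE)
    have h4 : 0 ≤ ∫ z in b..y, ‖u z‖ ^ 2 := integral_nonneg hy fun _ _ => by positivity
    rw [h2, abs_mul, abs_mul, abs_two, abs_of_nonneg h4]
    gcongr
  have hgrow : ∀ d : ℝ, c < d → ∀ s : ℝ, (∀ y, d ≤ y → 0 ≤ s * ⟪u y, v y⟫_ℝ - 1) →
      ∀ y, d ≤ y → 2 * (y - d) ≤ s * (‖u y‖ ^ 2 - ‖u d‖ ^ 2) := by
    intro d hd s hs y hy
    have hmono : MonotoneOn (fun y => s * ‖u y‖ ^ 2 - 2 * y) (Ici d) := by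
      have hder : ∀ z, c < z → HasDerivAt (fun y => s * ‖u y‖ ^ 2 - 2 * y)
          (s * (2 * ⟪u z, v z⟫_ℝ) - 2) z := fun z hz => by
        convert! ((hI z hz).const_mul s).sub ((hasDerivAt_id z).const_mul (2 : ℝ)) using 1
        ring
      refine monotoneOn_of_deriv_nonneg (convex_Ici d)
        (fun z hz => (hder z (hd.trans_le hz)).continuousAt.continuousWithinAt)
        (fun z hz => ?_) fun z hz => ?_
      · rw [interior_Ici] at hz
        exact (hder z (hd.trans hz)).differentiableAt.differentiableWithinAt
      · rw [interior_Ici] at hz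
        rw [(hder z (hd.trans hz)).deriv]
        have := hs z (le_of_lt hz)
        linarith
    have := hmono (self_mem_Ici) hy hy
    dsimp only at this
    linarith
  set B := |⟪u b, v b⟫_ℝ| + 2 * |μ| * A + 1
  have hA : 0 ≤ A := setIntegral_nonneg measurableSet_Ioi fun _ _ => by positivity
  have hB : 0 < B := by positivity
  have hE0 : E = 0 := by
    rcases lt_trichotomy E 0 with hneg | h0 | hpos
    · exfalso
      set d := b + B / (-E)
      have hd : b ≤ d := by
        have : 0 ≤ B / (-E) := div_nonneg hB.le (by linarith)
        simp only [d]; linarith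
      have hg := hgrow d (hcb.trans_le hd) (-1) fun y hy => ?_
      · have := hg (d + ‖u d‖ ^ 2 + 1) (by have := sq_nonneg ‖u d‖; linarith)
        nlinarith [sq_nonneg ‖u d‖, sq_nonneg ‖u (d + ‖u d‖ ^ 2 + 1)‖]
      · have h1 := (abs_le.1 (hJform y (hd.trans hy))).2
        have h2 : E * (y - b) ≤ -B := by
          have : E * (y - b) ≤ E * (d - b) := mul_le_mul_of_nonpos_left (by linarith) hneg.le
          have h3 : E * (d - b) = -B := by
            rw [add_sub_cancel_left, div_neg, mul_neg, mul_div_cancel₀ _ hneg.ne]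
          linarith
        have := le_abs_self (⟪u b, v b⟫_ℝ)
        simp only [B] at h2
        linarith
    · exact h0
    · exfalso
      set d := b + B / E
      have hd : b ≤ d := by
        have : 0 ≤ B / E := div_nonneg hB.le hpos.le
        simp only [d]; linarith
      have hg := hgrow d (hcb.trans_le hd) 1 fun y hy => ?_
      · refine hnotbig (d + 1) (by linarith) fun y hy => ?_
        have := hg y (by linarith)
        nlinarith [sq_nonneg ‖u d‖]
      · have h1 := (abs_le.1 (hJform y (hd.trans hy))).1
        have h2 : B ≤ E * (y - b) := by
          have : E * (d - b) ≤ E * (y - b) := mul_le_mul_of_nonneg_left (by linarith) hpos.le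
          have h3 : E * (d - b) = B := by simp only [d]; field_simp; ring
          linarith
        have := neg_abs_le (⟪u b, v b⟫_ℝ)
        simp only [B] at h2
        linarith
  have hvu : ∀ y, c < y → ‖v y‖ ^ 2 = μ * ‖u y‖ ^ 2 := fun y hy => by
    have := hEc y hy; linarith
  rcases lt_or_gt_of_ne hμ with hneg | hpos
  · refine ⟨0, fun y hy => ?_⟩
    have := hvu y hy
    have : ‖v y‖ ^ 2 = 0 := by nlinarith [sq_nonneg ‖v y‖, sq_nonneg ‖u y‖]
    simpa using this
  · set γ := Real.sqrt μ
    have hγ : 0 < γ := Real.sqrt_pos.2 hpos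
    have hγ2 : γ ^ 2 = μ := Real.sq_sqrt hpos.le
    refine ⟨-γ, fun y hy => ?_⟩
    set N : ℝ → ℝ := fun y => 2 * μ * ‖u y‖ ^ 2 + 2 * γ * ⟪u y, v y⟫_ℝ
    have hN : ∀ y, c < y → N y = ‖v y + γ * u y‖ ^ 2 := by
      intro y hy
      rw [norm_add_sq_real, ← Complex.real_smul, real_inner_smul_right, norm_smul, mul_pow,
        Real.norm_eq_abs, sq_abs, hγ2, hvu y hy, real_inner_comm]
      simp only [N]; ring
    have hNd : ∀ y, c < y → HasDerivAt N (2 * γ * N y) y := by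
      intro y hy
      have := ((hI y hy).const_mul (2 * μ)).add ((hJ y hy).const_mul (2 * γ))
      convert! this using 1
      simp only [N, hE0, ← hγ2]; ring
    have hN0 : ∀ y, c < y → 0 ≤ N y := fun y hy => by rw [hN y hy]; positivity
    have hmono : MonotoneOn N (Ioi c) := by
      refine monotoneOn_of_deriv_nonneg (convex_Ioi c)
        (fun z hz => (hNd z hz).continuousAt.continuousWithinAt)
        (fun z hz => ?_) fun z hz => ?_
      · rw [interior_Ioi] at hz
        exact (hNd z hz).differentiableAt.differentiableWithinAt
      · rw [interior_Ioi] at hz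
        rw [(hNd z hz).deriv]
        exact mul_nonneg (by positivity) (hN0 z hz)
    have hle : ∀ z, c < z → N z ≤ 4 * μ * ‖u z‖ ^ 2 := by
      intro z hz
      have h1 : ‖v z - γ * u z‖ ^ 2 = 2 * μ * ‖u z‖ ^ 2 - 2 * γ * ⟪u z, v z⟫_ℝ := by
        rw [norm_sub_sq_real, ← Complex.real_smul, real_inner_smul_right, norm_smul, mul_pow,
          Real.norm_eq_abs, sq_abs, hγ2, hvu z hz, real_inner_comm]
        ring
      have := sq_nonneg ‖v z - γ * u z‖
      simp only [N]; linarith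
    have hNy : N y = 0 := by
      by_contra hne
      have hposN : 0 < N y := lt_of_le_of_ne (hN0 y hy) (Ne.symm hne)
      have h1 : IntegrableOn (fun _ : ℝ => N y) (Ioi y) := by
        refine Integrable.mono' ((hint.mono_set (Ioi_subset_Ioi hy.le)).const_mul (4 * μ))
          (by fun_prop) ?_
        refine (ae_restrict_iff' measurableSet_Ioi).2 (Eventually.of_forall fun z hz => ?_)
        rw [Real.norm_of_nonneg hposN.le]
        exact (hmono hy (hy.trans hz) (le_of_lt hz)).trans (hle z (hy.trans hz))
      rw [integrableOn_const_iff] at h1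
      simp [hne] at h1
    rw [hN y hy] at hNy
    have h2 : v y + γ * u y = 0 := by simpa using hNy
    push_cast
    linear_combination h2

/-- The coefficient of `w (·, y)` against the character `exp (i lam x)` on `[0, L]`
(not normalised). -/
noncomputable def charCoeff (L : ℝ) (w : ℝ × ℝ → ℂ) (lam y : ℝ) : ℂ :=
  ∫ x in (0 : ℝ)..L, w (x, y) * Complex.exp (-(lam * x * Complex.I))

theorem continuous_charCoeff (L : ℝ) {w : ℝ × ℝ → ℂ} (hw : Continuous w) (lam : ℝ) :
    Continuous (charCoeff L w lam) := by
  unfold charCoeff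
  refine continuous_parametric_intervalIntegral_of_continuous'
    (f := fun y x => w (x, y) * Complex.exp (-(lam * x * Complex.I))) ?_ 0 L
  simp only [Function.uncurry_def]
  fun_prop

theorem integral_deriv_mul_char {L lam : ℝ} {g g' : ℝ → ℂ} (hg : ∀ x, HasDerivAt g (g' x) x)
    (hg' : Continuous g') (hL : g L * Complex.exp (-(lam * L * Complex.I)) = g 0) :
    ∫ x in (0 : ℝ)..L, g' x * Complex.exp (-(lam * x * Complex.I))
      = lam * Complex.I * ∫ x in (0 : ℝ)..L, g x * Complex.exp (-(lam * x * Complex.I)) := by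
  have hgc : Continuous g := continuous_iff_continuousAt.2 fun x => (hg x).continuousAt
  have he : ∀ x : ℝ, HasDerivAt (fun x : ℝ => Complex.exp (-(lam * x * Complex.I)))
      (Complex.exp (-(lam * x * Complex.I)) * -(lam * 1 * Complex.I)) x := fun x => by
    have h1 : HasDerivAt (fun z : ℂ => Complex.exp (-(lam * z * Complex.I)))
        (Complex.exp (-(lam * x * Complex.I)) * -(lam * 1 * Complex.I)) (x : ℂ) :=
      ((((hasDerivAt_id (x : ℂ)).const_mul (lam : ℂ)).mul_const Complex.I).neg).cexp
    exact h1.comp_ofReal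
  have := integral_deriv_mul_eq_sub (a := 0) (b := L) (fun x _ => hg x) (fun x _ => he x)
    (hg'.intervalIntegrable _ _)
    ((by fun_prop : Continuous fun x : ℝ =>
      Complex.exp (-(lam * x * Complex.I)) * -(lam * 1 * Complex.I)).intervalIntegrable _ _)
  rw [hL, intervalIntegral.integral_add] at this
  · rw [← intervalIntegral.integral_const_mul]
    simp only [Complex.ofReal_zero, mul_zero, zero_mul, neg_zero, Complex.exp_zero, mul_one,
      sub_self] at this
    rw [eq_neg_of_add_eq_zero_left this, ← intervalIntegral.integral_neg]
    exact integral_congr fun x _ => by ring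
  · exact (by fun_prop : Continuous fun x : ℝ =>
      g' x * Complex.exp (-(lam * x * Complex.I))).intervalIntegrable _ _
  · exact (by fun_prop : Continuous fun x : ℝ =>
      g x * (Complex.exp (-(lam * x * Complex.I)) * -(lam * 1 * Complex.I))).intervalIntegrable _ _

theorem hasDerivAt_charCoeff {L c : ℝ} (lam : ℝ) {W W2 : ℝ × ℝ → ℂ} (hW : Continuous W)
    (hW2 : Continuous W2)
    (hy : ∀ p : ℝ × ℝ, c < p.2 → HasDerivAt (fun t => W (p.1, t)) (W2 p) p.2) {y : ℝ}
    (hcy : c < y) : HasDerivAt (charCoeff L W lam) (charCoeff L W2 lam y) y := by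
  have hc : Continuous fun p : ℝ × ℝ => W2 p * Complex.exp (-(lam * p.1 * Complex.I)) := by
    fun_prop
  have hK : IsCompact (uIcc 0 L ×ˢ Icc (y - (y - c) / 2) (y + (y - c) / 2)) :=
    isCompact_uIcc.prod isCompact_Icc
  obtain ⟨C, hC⟩ := hK.exists_bound_of_continuousOn hc.continuousOn
  refine (intervalIntegral.hasDerivAt_integral_of_dominated_loc_of_deriv_le
    (F := fun y x => W (x, y) * Complex.exp (-(lam * x * Complex.I)))
    (F' := fun y x => W2 (x, y) * Complex.exp (-(lam * x * Complex.I))) (bound := fun _ => C)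
    (s := Icc (y - (y - c) / 2) (y + (y - c) / 2)) (Icc_mem_nhds (by linarith) (by linarith))
    ?_ ?_ ?_ ?_ ?_ ?_).2
  · exact Eventually.of_forall fun z => Continuous.aestronglyMeasurable (by fun_prop)
  · exact Continuous.intervalIntegrable (by fun_prop) _ _
  · exact Continuous.aestronglyMeasurable (by fun_prop)
  · exact Eventually.of_forall fun x hx z hz => hC (x, z) ⟨uIoc_subset_uIcc hx, hz⟩
  · simp
  · exact Eventually.of_forall fun x hx z hz =>
      (hy (x, z) (by dsimp only; linarith [hz.1])).mul_const _

/-- The coefficients of a solution of the Helmholtz equation satisfy `v' = (lam² - k²) u`.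
The second horizontal derivative enters only in integrated form. -/
theorem hasDerivAt_charCoeff_snd {L c k lam : ℝ} {W W1 W2 : ℝ × ℝ → ℂ}
    (hW : Continuous W) (hW1 : Continuous W1) (hW2 : Continuous W2)
    (hx : ∀ p : ℝ × ℝ, c < p.2 → HasDerivAt (fun t => W (t, p.2)) (W1 p) p.1)
    (hqp : ∀ y, W (L, y) * Complex.exp (-(lam * L * Complex.I)) = W (0, y))
    (hqp1 : ∀ y, W1 (L, y) * Complex.exp (-(lam * L * Complex.I)) = W1 (0, y))
    (hΦ : ∀ x y, c < y → HasDerivAt (fun x => ∫ t in c..y, W1 (x, t))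
      (-((k : ℂ) ^ 2 * ∫ t in c..y, W (x, t)) - W2 (x, y) + W2 (x, c)) x) {y : ℝ} (hcy : c < y) :
    HasDerivAt (charCoeff L W2 lam) (((lam ^ 2 - k ^ 2 : ℝ) : ℂ) * charCoeff L W lam y) y := by
  set e : ℝ → ℂ := fun x => Complex.exp (-(lam * x * Complex.I))
  have he : Continuous e := by fun_prop
  have hswap : ∀ {G : ℝ × ℝ → ℂ}, Continuous G → ∀ y,
      ∫ x in (0 : ℝ)..L, (∫ t in c..y, G (x, t)) * e x = ∫ t in c..y, charCoeff L G lam t := by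
    intro G hG y
    simp only [← intervalIntegral.integral_mul_const, charCoeff]
    refine intervalIntegral_intervalIntegral_swap ?_
    have hc : Continuous (Function.uncurry fun x t => G (x, t) * e x) := by
      simp only [Function.uncurry_def]; fun_prop
    exact (hc.continuousOn.integrableOn_compact (isCompact_uIcc.prod isCompact_uIcc)).mono_set
      (prod_mono uIoc_subset_uIcc uIoc_subset_uIcc)
  have hpar : ∀ {G : ℝ × ℝ → ℂ}, Continuous G → ∀ y, Continuous fun x => ∫ t in c..y, G (x, t) :=
    fun hG y => continuous_parametric_intervalIntegral_of_continuous' (by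
      simp only [Function.uncurry_def]; fun_prop) c y
  have hform : ∀ y, c < y → charCoeff L W2 lam y = charCoeff L W2 lam c
      + ((lam ^ 2 - k ^ 2 : ℝ) : ℂ) * ∫ t in c..y, charCoeff L W lam t := by
    intro y hy
    have h1 := integral_deriv_mul_char (lam := lam) (L := L) (fun x => hΦ x y hy)
      (by have := hpar hW y; fun_prop)
      (by rw [← intervalIntegral.integral_mul_const]; exact integral_congr fun t _ => hqp1 t)
    have h2 : ∫ t in c..y, charCoeff L W1 lam t
        = lam * Complex.I * ∫ t in c..y, charCoeff L W lam t := by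
      rw [← intervalIntegral.integral_const_mul, integral_of_le hy.le, integral_of_le hy.le]
      refine setIntegral_congr_fun measurableSet_Ioc fun t ht => ?_
      exact integral_deriv_mul_char (fun x => hx (x, t) ht.1) (by fun_prop) (hqp t)
    have h3 : ∫ x in (0 : ℝ)..L, (-((k : ℂ) ^ 2 * ∫ t in c..y, W (x, t)) - W2 (x, y) + W2 (x, c))
        * e x = -((k : ℂ) ^ 2 * ∫ t in c..y, charCoeff L W lam t) - charCoeff L W2 lam y
          + charCoeff L W2 lam c := by
      rw [← hswap hW, charCoeff, charCoeff, ← intervalIntegral.integral_const_mul,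
        ← intervalIntegral.integral_neg, ← intervalIntegral.integral_sub,
        ← intervalIntegral.integral_add]
      · exact integral_congr fun x _ => by simp only [e]; ring
      all_goals
        have := hpar hW y
        exact Continuous.intervalIntegrable (by fun_prop) _ _
    have h4 := hswap hW1 y
    simp only [e] at h3 h4
    rw [h3, h4, h2] at h1
    push_cast
    linear_combination -h1 - (lam : ℂ) ^ 2 * (∫ t in c..y, charCoeff L W lam t) * Complex.I_sq
  have hd : HasDerivAt (fun y => charCoeff L W2 lam c
      + ((lam ^ 2 - k ^ 2 : ℝ) : ℂ) * ∫ t in c..y, charCoeff L W lam t)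
      (((lam ^ 2 - k ^ 2 : ℝ) : ℂ) * charCoeff L W lam y) y :=
    (((continuous_charCoeff L hW lam).integral_hasStrictDerivAt c y).hasDerivAt.const_mul
      _).const_add _
  refine hd.congr_of_eventuallyEq ?_
  filter_upwards [Ioi_mem_nhds hcy] with z hz using hform z hz

/-- A quasiperiodic solution of the Helmholtz equation above the graph of `f` that vanishes on the
graph, extended by `0` below it; its first partial derivatives `W1`, `W2` are extended
continuously. -/
structure IsExtendedSolution (L k κ : ℝ) (f : ℝ → ℝ) (W W1 W2 W11 W22 : ℝ × ℝ → ℂ) : Prop where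
  pos : 0 < L
  nonresonant : ∀ j : ℤ, (κ + 2 * Real.pi * j / L) ^ 2 ≠ k ^ 2
  lipschitz : ∃ K, LipschitzWith K f
  periodic : Function.Periodic f L
  nonneg : ∀ x, 0 ≤ f x
  cont : Continuous W
  cont1 : Continuous W1
  cont2 : Continuous W2
  cont11 : ContinuousOn W11 {p : ℝ × ℝ | f p.1 < p.2}
  cont22 : ContinuousOn W22 {p : ℝ × ℝ | f p.1 < p.2}
  deriv1 : ∀ p : ℝ × ℝ, f p.1 < p.2 → HasDerivAt (fun t => W (t, p.2)) (W1 p) p.1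
  deriv2 : ∀ p : ℝ × ℝ, f p.1 < p.2 → HasDerivAt (fun t => W (p.1, t)) (W2 p) p.2
  deriv11 : ∀ p : ℝ × ℝ, f p.1 < p.2 → HasDerivAt (fun t => W1 (t, p.2)) (W11 p) p.1
  deriv22 : ∀ p : ℝ × ℝ, f p.1 < p.2 → HasDerivAt (fun t => W2 (p.1, t)) (W22 p) p.2
  helmholtz : ∀ p : ℝ × ℝ, f p.1 < p.2 → W11 p + W22 p = -((k : ℂ) ^ 2 * W p)
  zero_below : ∀ x y, y ≤ f x → W (x, y) = 0
  below1 : ∀ x y, y ≤ f x → W1 (x, y) = W1 (x, f x)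
  below2 : ∀ x y, y ≤ f x → W2 (x, y) = W2 (x, f x)
  boundary1 : ∀ x, W1 (x, f x) = 0 → HasDerivAt (fun t => W (t, f x)) 0 x
  boundary2 : ∀ x, HasDerivWithinAt (fun t => W (x, t)) (W2 (x, f x)) (Ici (f x)) (f x)
  quasi : ∀ x y, W (x + L, y) = Complex.exp (κ * L * Complex.I) * W (x, y)
  quasi1 : ∀ x y, W1 (x + L, y) = Complex.exp (κ * L * Complex.I) * W1 (x, y)
  quasi2 : ∀ x y, W2 (x + L, y) = Complex.exp (κ * L * Complex.I) * W2 (x, y)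
  sq_integrable : IntegrableOn (fun p => ‖W p‖ ^ 2) {p : ℝ × ℝ | 0 ≤ p.1 ∧ p.1 ≤ L ∧ f p.1 ≤ p.2}

theorem mul_char_eq_of_quasiperiodic {L κ : ℝ} (hL : L ≠ 0) (j : ℤ) {g : ℝ → ℂ}
    (hg : ∀ x, g (x + L) = Complex.exp (κ * L * Complex.I) * g x) :
    g L * Complex.exp (-((κ + 2 * Real.pi * j / L : ℝ) * L * Complex.I)) = g 0 := by
  have h1 := hg 0
  rw [zero_add] at h1
  have h2 : Complex.exp (κ * L * Complex.I) *
      Complex.exp (-((κ + 2 * Real.pi * j / L : ℝ) * L * Complex.I)) = 1 := by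
    rw [← Complex.exp_add, Complex.exp_eq_one_iff]
    refine ⟨-j, ?_⟩
    have : (L : ℂ) ≠ 0 := by exact_mod_cast hL
    push_cast
    field_simp
    ring
  rw [h1, mul_right_comm, h2, one_mul]

theorem eq_zero_of_quasiperiodic {L : ℝ} (hL : 0 < L) {ν : ℂ} (hν : ν ≠ 0) {g : ℝ → ℂ}
    (hg : ∀ x, g (x + L) = ν * g x) (h0 : ∀ x ∈ Icc 0 L, g x = 0) (x : ℝ) : g x = 0 := by
  have hp : Function.Periodic (fun x => g x = 0) L := fun x => by simp [hg, hν]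
  obtain ⟨y, hy, hxy⟩ := hp.exists_mem_Ico₀ hL x
  simp only [eq_iff_iff] at hxy
  exact hxy.2 (h0 y ⟨hy.1, hy.2.le⟩)

namespace IsExtendedSolution

variable {L k κ : ℝ} {f : ℝ → ℝ} {W W1 W2 W11 W22 : ℝ × ℝ → ℂ}

theorem exists_lt (S : IsExtendedSolution L k κ f W W1 W2 W11 W22) : ∃ c, ∀ x, f x < c := by
  obtain ⟨K, hK⟩ := S.lipschitz
  obtain ⟨C, hC⟩ := isCompact_Icc.exists_bound_of_continuousOn
    (hK.continuous.continuousOn (s := Icc (0 : ℝ) L))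
  refine ⟨C + 1, fun x => ?_⟩
  obtain ⟨y, hy, hxy⟩ := S.periodic.exists_mem_Ico₀ S.pos x
  have := (abs_le.1 (hC y ⟨hy.1, hy.2.le⟩)).2
  linarith

theorem hasDerivAt_integral_above (S : IsExtendedSolution L k κ f W W1 W2 W11 W22) {g : ℝ → ℝ}
    {K : NNReal} (hg : LipschitzWith K g) (hfg : ∀ x, f x ≤ g x) {x y : ℝ} (hy : g x < y) :
    (fun z => (∫ t in g z..y, W1 (z, t)) - (∫ t in g x..y, W1 (x, t))
      + (g z - g x) • W1 (x, g x)
      - (z - x) • (-((k : ℂ) ^ 2 * ∫ t in g x..y, W (x, t)) - W2 (x, y) + W2 (x, g x)))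
      =o[𝓝 x] fun z => z - x := by
  have hsub : {p : ℝ × ℝ | g p.1 < p.2} ⊆ {p : ℝ × ℝ | f p.1 < p.2} := fun p hp =>
    (hfg p.1).trans_lt hp
  have hW := S.cont
  have := isLittleO_integral_above_graph_of_div hg S.cont1 S.cont2
    (g := fun p => -((k : ℂ) ^ 2 * W p)) (by fun_prop)
    (fun p hp => S.deriv11 p (hsub hp)) (fun p hp => S.deriv22 p (hsub hp))
    (S.cont11.mono hsub) (S.cont22.mono hsub) (fun p hp => S.helmholtz p (hsub hp)) hy
  simpa only [intervalIntegral.integral_neg, intervalIntegral.integral_const_mul] using this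

theorem charCoeff_norm_sq_le (S : IsExtendedSolution L k κ f W W1 W2 W11 W22) (j : ℤ) (y : ℝ) :
    ‖charCoeff L W (κ + 2 * Real.pi * j / L) y‖ ^ 2 ≤ L * ∫ x in (0 : ℝ)..L, ‖W (x, y)‖ ^ 2 := by
  have hW := S.cont
  have hs := hasSum_inner_quasiFourier S.pos κ (g := fun x => W (x, y)) (h := fun x => W (x, y))
    (by fun_prop) (by fun_prop)
  simp only [real_inner_self_eq_norm_sq] at hs
  exact le_hasSum hs j fun i _ => sq_nonneg _

theorem integrableOn_charCoeff (S : IsExtendedSolution L k κ f W W1 W2 W11 W22) {c : ℝ}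
    (hc : ∀ x, f x < c) (j : ℤ) :
    IntegrableOn (fun y => ‖charCoeff L W (κ + 2 * Real.pi * j / L) y‖ ^ 2) (Ioi c) := by
  have h1 : IntegrableOn (fun p => ‖W p‖ ^ 2) (Ioc 0 L ×ˢ Ioi c) :=
    S.sq_integrable.mono_set fun p hp => ⟨hp.1.1.le, hp.1.2, ((hc p.1).trans hp.2).le⟩
  rw [IntegrableOn, Measure.volume_eq_prod, ← Measure.prod_restrict] at h1
  have h2 := h1.integral_prod_right.const_mul L
  refine h2.mono' ((continuous_charCoeff L S.cont _).norm.pow 2).aestronglyMeasurable ?_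
  refine Eventually.of_forall fun y => ?_
  have := S.charCoeff_norm_sq_le j y
  rw [integral_of_le S.pos.le] at this
  simpa using this

/-- Above the graph, the flux between a solution and its vertical translate vanishes. -/
theorem integral_flux_top (S : IsExtendedSolution L k κ f W W1 W2 W11 W22) {c h h' : ℝ}
    (hc : ∀ x, f x < c) (hh : c < h) (hh' : c < h') :
    ∫ x in (0 : ℝ)..L, (⟪W (x, h), W2 (x, h')⟫_ℝ - ⟪W (x, h'), W2 (x, h)⟫_ℝ) = 0 := by
  have hW := S.cont
  have hW2 := S.cont2
  have hs1 := hasSum_inner_quasiFourier S.pos κ (g := fun x => W (x, h)) (h := fun x => W2 (x, h'))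
    (by fun_prop) (by fun_prop)
  have hs2 := hasSum_inner_quasiFourier S.pos κ (g := fun x => W (x, h')) (h := fun x => W2 (x, h))
    (by fun_prop) (by fun_prop)
  have hs := hs1.sub hs2
  rw [← mul_sub, ← intervalIntegral.integral_sub] at hs
  · have h0 : ∀ j : ℤ, ⟪charCoeff L W (κ + 2 * Real.pi * j / L) h,
          charCoeff L W2 (κ + 2 * Real.pi * j / L) h'⟫_ℝ
        - ⟪charCoeff L W (κ + 2 * Real.pi * j / L) h',
          charCoeff L W2 (κ + 2 * Real.pi * j / L) h⟫_ℝ = 0 := by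
      intro j
      have hΦ : ∀ x y, c < y → HasDerivAt (fun x => ∫ t in c..y, W1 (x, t))
          (-((k : ℂ) ^ 2 * ∫ t in c..y, W (x, t)) - W2 (x, y) + W2 (x, c)) x := by
        intro x y hy
        rw [hasDerivAt_iff_isLittleO]
        simpa using S.hasDerivAt_integral_above (LipschitzWith.const c) (fun x => (hc x).le) hy
      obtain ⟨r, hr⟩ := exists_real_smul_of_integrableOn
        (sub_ne_zero.2 (S.nonresonant j))
        (fun y hy => hasDerivAt_charCoeff (L := L) (κ + 2 * Real.pi * j / L) hW hW2
          (fun p hp => S.deriv2 p ((hc p.1).trans hp)) hy)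
        (fun y hy => hasDerivAt_charCoeff_snd hW S.cont1 hW2
          (fun p hp => S.deriv1 p ((hc p.1).trans hp))
          (fun y => mul_char_eq_of_quasiperiodic S.pos.ne' j (g := fun x => W (x, y))
            fun x => S.quasi x y)
          (fun y => mul_char_eq_of_quasiperiodic S.pos.ne' j (g := fun x => W1 (x, y))
            fun x => S.quasi1 x y) hΦ hy)
        (S.integrableOn_charCoeff hc j)
      rw [hr h hh, hr h' hh', ← Complex.real_smul, ← Complex.real_smul, real_inner_smul_right,
        real_inner_smul_right, real_inner_comm, sub_self]
    have := hs.tsum_eq.symm.trans ((tsum_congr h0).trans tsum_zero)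
    exact (mul_eq_zero.1 this).resolve_left S.pos.ne'
  all_goals exact Continuous.intervalIntegrable (by fun_prop) _ _

end IsExtendedSolution

/-- Integration of a first-order expansion along a Lipschitz function `f`. -/
theorem integral_eq_sub_of_isLittleO {f Q A B : ℝ → ℝ} {K : NNReal} (hf : LipschitzWith K f)
    (hA : Continuous A) (hB : Continuous B)
    (hQ : ∀ x, (fun z => Q z - Q x + (f z - f x) * A x - (z - x) * B x) =o[𝓝 x] fun z => z - x)
    {a b : ℝ} (hab : a ≤ b) : ∫ x in a..b, (B x - deriv f x * A x) = Q b - Q a := by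
  obtain ⟨C₁, hC₁⟩ := isCompact_Icc.exists_bound_of_continuousOn (hA.continuousOn (s := Icc a b))
  obtain ⟨C₂, hC₂⟩ := isCompact_Icc.exists_bound_of_continuousOn (hB.continuousOn (s := Icc a b))
  have hlip : LipschitzOnWith (K * C₁.toNNReal + C₂.toNNReal + 1) Q (Icc a b) := by
    refine lipschitzOnWith_of_eventually_norm_sub_le fun x hx => ?_
    filter_upwards [(hQ x).bound zero_lt_one] with z hz
    have hfz : |f z - f x| ≤ K * |z - x| := by
      simpa only [Real.dist_eq] using hf.dist_le_mul z x
    have hAx : |A x| ≤ C₁.toNNReal := (hC₁ x hx).trans (Real.le_coe_toNNReal _)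
    have hBx : |B x| ≤ C₂.toNNReal := (hC₂ x hx).trans (Real.le_coe_toNNReal _)
    have e : Q z - Q x = (Q z - Q x + (f z - f x) * A x - (z - x) * B x)
        - (f z - f x) * A x + (z - x) * B x := by ring
    rw [e]
    calc _ ≤ 1 * |z - x| + K * |z - x| * C₁.toNNReal + |z - x| * C₂.toNNReal := by
          refine (norm_add_le _ _).trans (add_le_add ((norm_sub_le _ _).trans
            (add_le_add hz ?_)) ?_)
          · rw [norm_mul]
            exact mul_le_mul hfz hAx (abs_nonneg _) (by positivity)
          · rw [norm_mul]
            exact mul_le_mul_of_nonneg_left hBx (abs_nonneg _)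
      _ = _ := by push_cast; ring
  rw [← uIcc_of_le hab] at hlip
  rw [← hlip.absolutelyContinuousOnInterval.integral_deriv_eq_sub]
  refine intervalIntegral.integral_congr_ae ?_
  filter_upwards [hf.ae_differentiableAt_real] with x hx _
  refine (HasDerivAt.deriv ?_).symm
  rw [hasDerivAt_iff_isLittleO]
  refine ((hQ x).sub ((hasDerivAt_iff_isLittleO.1 hx.hasDerivAt).const_mul_left (A x))).congr_left
    fun z => ?_
  simp only [smul_eq_mul]
  ring

theorem real_inner_mul_mul_of_norm_eq_one {ν : ℂ} (hν : ‖ν‖ = 1) (a b : ℂ) :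
    ⟪ν * a, ν * b⟫_ℝ = ⟪a, b⟫_ℝ := by
  have h : ν * conj ν = 1 := by rw [Complex.mul_conj, Complex.normSq_eq_norm_sq, hν]; simp
  rw [Complex.inner, Complex.inner, map_mul]
  congr 1
  linear_combination (conj a * b) * h

theorem norm_exp_mul_mul_I (κ L : ℝ) : ‖Complex.exp (κ * L * Complex.I)‖ = 1 := by
  rw [← Complex.ofReal_mul]
  exact Complex.norm_exp_ofReal_mul_I _

namespace IsExtendedSolution

variable {L k κ : ℝ} {f : ℝ → ℝ} {W W1 W2 W11 W22 : ℝ × ℝ → ℂ}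

theorem continuous_graph (S : IsExtendedSolution L k κ f W W1 W2 W11 W22) : Continuous f :=
  S.lipschitz.choose_spec.continuous

theorem intervalIntegrable_weight (S : IsExtendedSolution L k κ f W W1 W2 W11 W22) (a b : ℝ) :
    IntervalIntegrable (fun x => 1 + deriv f x ^ 2) volume a b := by
  obtain ⟨K, hK⟩ := S.lipschitz
  refine (intervalIntegrable_const (c := 1 + (K : ℝ) ^ 2)).mono_fun'
    ((((measurable_deriv f).pow_const 2).const_add 1).aestronglyMeasurable)
    (Eventually.of_forall fun x => ?_)
  have h1 : |deriv f x| ≤ K := norm_deriv_le_of_lipschitz hK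
  beta_reduce
  rw [Real.norm_eq_abs, abs_of_nonneg (by positivity), ← sq_abs]
  gcongr

theorem integral_deriv2 (S : IsExtendedSolution L k κ f W W1 W2 W11 W22) {x b : ℝ} (hb : f x ≤ b) :
    ∫ t in f x..b, W2 (x, t) = W (x, b) := by
  have hW := S.cont
  have hW2 := S.cont2
  have := integral_eq_sub_of_hasDerivAt_of_le (f := fun t => W (x, t)) (f' := fun t => W2 (x, t)) hb
    (by fun_prop) (fun t ht => S.deriv2 (x, t) ht.1)
    (Continuous.intervalIntegrable (by fun_prop) _ _)
  rwa [S.zero_below x _ le_rfl, sub_zero] at this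

/-- The tangential derivative of the solution vanishes on the graph. -/
theorem boundary1_eq (S : IsExtendedSolution L k κ f W W1 W2 W11 W22) {x d : ℝ}
    (hd : HasDerivAt f d x) : W1 (x, f x) = -(d • W2 (x, f x)) := by
  obtain ⟨c, hc⟩ := S.exists_lt
  obtain ⟨K, hK⟩ := S.lipschitz
  have hW := S.cont
  have hW1 := S.cont1
  have hW2 := S.cont2
  have hrect : ∀ z a, (∀ ξ ∈ uIcc x z, f ξ < a) → a ≤ c →
      ∫ t in a..c, (W2 (z, t) - W2 (x, t)) = ∫ ξ in x..z, (W1 (ξ, c) - W1 (ξ, a)) := by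
    intro z a ha hac
    have h2 : ∀ y, f y < a → ∫ t in a..c, W2 (y, t) = W (y, c) - W (y, a) := fun y hy =>
      integral_eq_sub_of_hasDerivAt (f := fun t => W (y, t)) (fun t ht => S.deriv2 (y, t)
        (by rw [uIcc_of_le hac] at ht; exact hy.trans_le ht.1))
        (Continuous.intervalIntegrable (by fun_prop) _ _)
    have h1 : ∀ b, a ≤ b → ∫ ξ in x..z, W1 (ξ, b) = W (z, b) - W (x, b) := fun b hb =>
      integral_eq_sub_of_hasDerivAt (f := fun ξ => W (ξ, b))
        (fun ξ hξ => S.deriv1 (ξ, b) ((ha ξ hξ).trans_le hb))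
        (Continuous.intervalIntegrable (by fun_prop) _ _)
    rw [intervalIntegral.integral_sub, intervalIntegral.integral_sub, h1 c hac, h1 a le_rfl,
      h2 z (ha z right_mem_uIcc), h2 x (ha x left_mem_uIcc)]
    · abel
    all_goals exact Continuous.intervalIntegrable (by fun_prop) _ _
  have h1 := isLittleO_integral_above_graph hK hW2 (R := fun p => W1 (p.1, c) - W1 p)
    (by fun_prop) (hc x) hrect
  simp only [S.integral_deriv2 (hc _).le] at h1
  have h2 := h1.sub (hasDerivAt_iff_isLittleO.1 (S.deriv1 (x, c) (hc x)))
  have h3 : HasDerivAt (fun z => f z • W2 (x, f x)) (-W1 (x, f x)) x := by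
    rw [hasDerivAt_iff_isLittleO]
    refine h2.congr_left fun z => ?_
    simp only
    module
  rw [← h3.unique (hd.smul_const (W2 (x, f x))), neg_neg]

theorem integral_flux_graph (S : IsExtendedSolution L k κ f W W1 W2 W11 W22) {s : ℝ} (hs : 0 < s) :
    ∫ x in (0 : ℝ)..L, (1 + deriv f x ^ 2) * ⟪W (x, f x + s), W2 (x, f x)⟫_ℝ = 0 := by
  obtain ⟨c, hc⟩ := S.exists_lt
  obtain ⟨K, hK⟩ := S.lipschitz
  have hW := S.cont
  have hW1 := S.cont1
  have hW2 := S.cont2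
  have hfc := S.continuous_graph
  set h := c + 1
  have hh : ∀ x, f x < h := fun x => (hc x).trans (by simp [h])
  set F : ℝ × ℝ → ℝ := fun p => ⟪W p, W1 (p.1, p.2 + s)⟫_ℝ - ⟪W (p.1, p.2 + s), W1 p⟫_ℝ with hF
  set G : ℝ × ℝ → ℝ := fun p => ⟪W p, W2 (p.1, p.2 + s)⟫_ℝ - ⟪W (p.1, p.2 + s), W2 p⟫_ℝ with hG
  have hFc : Continuous F := by fun_prop
  have hGc : Continuous G := by fun_prop
  have hup : ∀ p : ℝ × ℝ, f p.1 < p.2 → f p.1 < p.2 + s := fun p hp => by linarith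
  have hsh : ContinuousOn (fun p : ℝ × ℝ => (p.1, p.2 + s)) {p : ℝ × ℝ | f p.1 < p.2} := by
    fun_prop
  have hexp : ∀ x, (fun z => (∫ t in f z..h, F (z, t)) - (∫ t in f x..h, F (x, t))
      + (f z - f x) * F (x, f x) - (z - x) * (-G (x, h) + G (x, f x)))
      =o[𝓝 x] fun z => z - x := by
    intro x
    have := isLittleO_integral_above_graph_of_div hK hFc hGc (g := fun _ => 0) (by fun_prop)
      (F' := fun p => ⟪W p, W11 (p.1, p.2 + s)⟫_ℝ - ⟪W (p.1, p.2 + s), W11 p⟫_ℝ)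
      (G' := fun p => ⟪W p, W22 (p.1, p.2 + s)⟫_ℝ - ⟪W (p.1, p.2 + s), W22 p⟫_ℝ)
      ?_ ?_ ?_ ?_ ?_ (hh x)
    · simpa using this
    · intro p hp
      have := ((S.deriv1 p hp).inner ℝ (S.deriv11 (p.1, p.2 + s) (hup p hp))).sub
        ((S.deriv1 (p.1, p.2 + s) (hup p hp)).inner ℝ (S.deriv11 p hp))
      convert! this using 1
      rw [real_inner_comm (W1 p)]
      ring
    · intro p hp
      have hadd : HasDerivAt (fun t : ℝ => t + s) 1 p.2 := (hasDerivAt_id _).add_const s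
      have h1 : HasDerivAt (fun t => W (p.1, t + s)) (W2 (p.1, p.2 + s)) p.2 := by
        simpa [Function.comp_def] using (S.deriv2 (p.1, p.2 + s) (hup p hp)).scomp p.2 hadd
      have h2 : HasDerivAt (fun t => W2 (p.1, t + s)) (W22 (p.1, p.2 + s)) p.2 := by
        simpa [Function.comp_def] using (S.deriv22 (p.1, p.2 + s) (hup p hp)).scomp p.2 hadd
      have := ((S.deriv2 p hp).inner ℝ h2).sub (h1.inner ℝ (S.deriv22 p hp))
      convert! this using 1
      rw [real_inner_comm (W2 p)]
      ring
    · exact (hW.continuousOn.inner (S.cont11.comp hsh hup)).sub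
        ((hW.comp_continuousOn hsh).inner S.cont11)
    · exact (hW.continuousOn.inner (S.cont22.comp hsh hup)).sub
        ((hW.comp_continuousOn hsh).inner S.cont22)
    · intro p hp
      have e1 := S.helmholtz p hp
      have e2 := S.helmholtz (p.1, p.2 + s) (hup p hp)
      have hk : ∀ z : ℂ, (k : ℂ) ^ 2 * z = (k ^ 2 : ℝ) • z := fun z => by
        rw [Complex.real_smul]; push_cast; rfl
      calc _ = ⟪W p, W11 (p.1, p.2 + s) + W22 (p.1, p.2 + s)⟫_ℝ
            - ⟪W (p.1, p.2 + s), W11 p + W22 p⟫_ℝ := by rw [inner_add_right, inner_add_right]; ring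
        _ = 0 := by
          rw [e1, e2, hk, hk, inner_neg_right, inner_neg_right, real_inner_smul_right,
            real_inner_smul_right, real_inner_comm, sub_self]
  have hint := integral_eq_sub_of_isLittleO hK (Q := fun x => ∫ t in f x..h, F (x, t))
    (by fun_prop) (by fun_prop) hexp S.pos.le
  have hper : (∫ t in f L..h, F (L, t)) = ∫ t in f 0..h, F (0, t) := by
    have e1 : f L = f 0 := by simpa using S.periodic 0
    have e2 : ∀ t, W (L, t) = Complex.exp (κ * L * Complex.I) * W (0, t) := fun t => by
      simpa using S.quasi 0 t
    have e3 : ∀ t, W1 (L, t) = Complex.exp (κ * L * Complex.I) * W1 (0, t) := fun t => by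
      simpa using S.quasi1 0 t
    rw [e1]
    refine integral_congr fun t _ => ?_
    simp only [hF, e2, e3, real_inner_mul_mul_of_norm_eq_one (norm_exp_mul_mul_I κ L)]
  rw [hper, sub_self] at hint
  have htop : ∫ x in (0 : ℝ)..L, G (x, h) = 0 :=
    S.integral_flux_top (h := h) (h' := h + s) hc (lt_add_one c) (by simp only [h]; linarith)
  have hae : ∫ x in (0 : ℝ)..L, (-G (x, h) + G (x, f x) - deriv f x * F (x, f x))
      = ∫ x in (0 : ℝ)..L,
        (-G (x, h) - (1 + deriv f x ^ 2) * ⟪W (x, f x + s), W2 (x, f x)⟫_ℝ) := by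
    refine intervalIntegral.integral_congr_ae ?_
    filter_upwards [hK.ae_differentiableAt_real] with x hx _
    have e1 : F (x, f x) = deriv f x * ⟪W (x, f x + s), W2 (x, f x)⟫_ℝ := by
      simp only [hF]
      rw [S.boundary1_eq hx.hasDerivAt, S.zero_below x _ le_rfl, inner_zero_left, inner_neg_right,
        real_inner_smul_right]
      ring
    have e2 : G (x, f x) = -⟪W (x, f x + s), W2 (x, f x)⟫_ℝ := by
      simp only [hG]
      rw [S.zero_below x _ le_rfl, inner_zero_left, zero_sub]
    rw [e1, e2]
    ring
  have hI : IntervalIntegrable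
      (fun x => (1 + deriv f x ^ 2) * ⟪W (x, f x + s), W2 (x, f x)⟫_ℝ) volume 0 L := by
    refine IntervalIntegrable.mul_continuousOn ?_ (by fun_prop)
    exact S.intervalIntegrable_weight 0 L
  rw [hae, intervalIntegral.integral_sub ((by fun_prop :
    Continuous fun x => -G (x, h)).intervalIntegrable _ _) hI, intervalIntegral.integral_neg, htop,
    neg_zero, zero_sub, neg_eq_zero] at hint
  exact hint

/-- The normal derivative of the solution vanishes on the graph. -/
theorem boundary2_eq_zero (S : IsExtendedSolution L k κ f W W1 W2 W11 W22) (x : ℝ) :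
    W2 (x, f x) = 0 := by
  have hW := S.cont
  have hW2 := S.cont2
  have hfc := S.continuous_graph
  have hlim : Tendsto (fun s : ℝ => ∫ x in (0 : ℝ)..L,
      (1 + deriv f x ^ 2) * ⟪s⁻¹ • W (x, f x + s), W2 (x, f x)⟫_ℝ) (𝓝[>] 0)
      (𝓝 (∫ x in (0 : ℝ)..L, (1 + deriv f x ^ 2) * ⟪W2 (x, f x), W2 (x, f x)⟫_ℝ)) := by
    have hK : IsCompact (Icc (0 : ℝ) L ×ˢ Icc (0 : ℝ) 1) := isCompact_Icc.prod isCompact_Icc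
    have hcont : Continuous fun p : ℝ × ℝ => W2 (p.1, f p.1 + p.2) := by fun_prop
    obtain ⟨C, hC⟩ := hK.exists_bound_of_continuousOn hcont.continuousOn
    have hC0 : 0 ≤ C := (norm_nonneg _).trans
      (hC (0, 0) ⟨⟨le_rfl, S.pos.le⟩, ⟨le_rfl, zero_le_one⟩⟩)
    refine intervalIntegral.tendsto_integral_filter_of_dominated_convergence
      (fun x => (1 + deriv f x ^ 2) * (C * C)) ?_ ?_ ?_ ?_
    · refine Eventually.of_forall fun s => ?_
      exact (((measurable_deriv f).pow_const 2).const_add 1).aestronglyMeasurable.mul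
        (by fun_prop : Continuous fun x =>
          ⟪s⁻¹ • W (x, f x + s), W2 (x, f x)⟫_ℝ).aestronglyMeasurable
    · filter_upwards [Ioc_mem_nhdsGT zero_lt_one] with s hs
      refine Eventually.of_forall fun x hx => ?_
      rw [uIoc_of_le S.pos.le] at hx
      have hx' := Ioc_subset_Icc_self hx
      have h1 : ‖W (x, f x + s)‖ ≤ C * s := by
        rw [← S.integral_deriv2 (by linarith [hs.1])]
        refine (intervalIntegral.norm_integral_le_of_norm_le_const (C := C) fun t ht => ?_).trans ?_
        · rw [uIoc_of_le (by linarith [hs.1])] at ht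
          have := hC (x, t - f x) ⟨hx', by linarith [ht.1], by linarith [ht.2, hs.2]⟩
          simpa using this
        · rw [add_sub_cancel_left, abs_of_pos hs.1]
      have h2 : ‖s⁻¹ • W (x, f x + s)‖ ≤ C := by
        rw [norm_smul, norm_inv, Real.norm_of_nonneg hs.1.le, inv_mul_le_iff₀ hs.1, mul_comm]
        exact h1
      have h3 : ‖W2 (x, f x)‖ ≤ C := by
        simpa using hC (x, 0) ⟨hx', ⟨le_rfl, zero_le_one⟩⟩
      rw [norm_mul, Real.norm_of_nonneg (by positivity : 0 ≤ 1 + deriv f x ^ 2)]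
      gcongr
      exact (norm_inner_le_norm _ _).trans (mul_le_mul h2 h3 (norm_nonneg _) hC0)
    · exact (S.intervalIntegrable_weight 0 L).mul_const _
    · refine Eventually.of_forall fun x _ => Tendsto.const_mul _ ?_
      refine Tendsto.inner ?_ tendsto_const_nhds
      have h1 := (hasDerivWithinAt_iff_tendsto_slope' self_notMem_Ioi).1
        ((S.boundary2 x).mono Ioi_subset_Ici_self)
      have h2 : Tendsto (fun s : ℝ => f x + s) (𝓝[>] 0) (𝓝[>] (f x)) := by
        refine tendsto_nhdsWithin_iff.2 ⟨?_, ?_⟩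
        · have : Continuous fun s : ℝ => f x + s := by fun_prop
          simpa using (this.tendsto 0).mono_left nhdsWithin_le_nhds
        · filter_upwards [self_mem_nhdsWithin] with s hs
          simpa using hs
      refine (h1.comp h2).congr fun s => ?_
      simp [slope_def_module, S.zero_below x _ le_rfl]
  have hzero : ∫ x in (0 : ℝ)..L, (1 + deriv f x ^ 2) * ⟪W2 (x, f x), W2 (x, f x)⟫_ℝ = 0 := by
    refine tendsto_nhds_unique hlim (tendsto_const_nhds.congr' ?_)
    filter_upwards [self_mem_nhdsWithin] with s hs
    have : ∀ x, (1 + deriv f x ^ 2) * ⟪s⁻¹ • W (x, f x + s), W2 (x, f x)⟫_ℝ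
        = s⁻¹ * ((1 + deriv f x ^ 2) * ⟪W (x, f x + s), W2 (x, f x)⟫_ℝ) := fun x => by
      rw [real_inner_smul_left]; ring
    simp only [this, intervalIntegral.integral_const_mul, S.integral_flux_graph hs, mul_zero]
  have hle : ∫ x in (0 : ℝ)..L, ‖W2 (x, f x)‖ ^ 2 ≤ 0 := by
    refine le_of_le_of_eq ?_ hzero
    have h1 : Continuous fun x => ‖W2 (x, f x)‖ ^ 2 := by fun_prop
    have h2 : Continuous fun x => ⟪W2 (x, f x), W2 (x, f x)⟫_ℝ := by fun_prop
    refine intervalIntegral.integral_mono_on S.pos.le (h1.intervalIntegrable _ _)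
      ((S.intervalIntegrable_weight 0 L).mul_continuousOn h2.continuousOn) fun x _ => ?_
    rw [real_inner_self_eq_norm_sq]
    nlinarith [sq_nonneg (deriv f x), sq_nonneg ‖W2 (x, f x)‖,
      mul_nonneg (sq_nonneg (deriv f x)) (sq_nonneg ‖W2 (x, f x)‖)]
  refine eq_zero_of_quasiperiodic S.pos (Complex.exp_ne_zero (κ * L * Complex.I))
    (g := fun x => W2 (x, f x)) (fun x => ?_) (fun x hx => ?_) x
  · rw [S.periodic x, S.quasi2]
  · by_contra hne
    refine hle.not_gt (intervalIntegral.integral_pos S.pos (by fun_prop)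
      (fun _ _ => sq_nonneg _) ⟨x, hx, ?_⟩)
    have : 0 < ‖W2 (x, f x)‖ := norm_pos_iff.2 hne
    positivity

theorem boundary1_eq_zero (S : IsExtendedSolution L k κ f W W1 W2 W11 W22) (x : ℝ) :
    W1 (x, f x) = 0 := by
  obtain ⟨K, hK⟩ := S.lipschitz
  have hW1 := S.cont1
  have hfc := S.continuous_graph
  have hae : (fun x => W1 (x, f x)) =ᵐ[volume] fun _ => 0 := by
    filter_upwards [hK.ae_differentiableAt_real] with x hx
    rw [S.boundary1_eq hx.hasDerivAt, S.boundary2_eq_zero, smul_zero, neg_zero]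
  exact congrFun ((Continuous.ae_eq_iff_eq volume (by fun_prop) continuous_const).1 hae) x

theorem hasDerivAt_fst (S : IsExtendedSolution L k κ f W W1 W2 W11 W22) (p : ℝ × ℝ) :
    HasDerivAt (fun t => W (t, p.2)) (W1 p) p.1 := by
  obtain ⟨x, y⟩ := p
  rcases lt_trichotomy (f x) y with h | rfl | h
  · exact S.deriv1 (x, y) h
  · have := S.boundary1 x (S.boundary1_eq_zero x)
    rwa [← S.boundary1_eq_zero x] at this
  · dsimp only
    rw [S.below1 x y h.le, S.boundary1_eq_zero x]
    refine (hasDerivAt_const x (0 : ℂ)).congr_of_eventuallyEq ?_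
    filter_upwards [S.continuous_graph.continuousAt.eventually (lt_mem_nhds h)] with t ht
    exact S.zero_below t y ht.le

theorem hasDerivAt_snd (S : IsExtendedSolution L k κ f W W1 W2 W11 W22) (p : ℝ × ℝ) :
    HasDerivAt (fun t => W (p.1, t)) (W2 p) p.2 := by
  obtain ⟨x, y⟩ := p
  dsimp only
  rcases lt_trichotomy (f x) y with h | rfl | h
  · exact S.deriv2 (x, y) h
  · have h1 := S.boundary2 x
    have h2 : HasDerivWithinAt (fun t => W (x, t)) (W2 (x, f x)) (Iic (f x)) (f x) := by
      rw [S.boundary2_eq_zero x]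
      exact (hasDerivWithinAt_const (f x) (Iic (f x)) (0 : ℂ)).congr
        (fun t ht => S.zero_below x t ht) (S.zero_below x _ le_rfl)
    have := h1.union h2
    rwa [Ici_union_Iic, hasDerivWithinAt_univ] at this
  · rw [S.below2 x y h.le, S.boundary2_eq_zero x]
    refine (hasDerivAt_const y (0 : ℂ)).congr_of_eventuallyEq ?_
    filter_upwards [Iio_mem_nhds h] with t ht
    exact S.zero_below x t (le_of_lt ht)

theorem hasDerivAt_integral_fst (S : IsExtendedSolution L k κ f W W1 W2 W11 W22) {c : ℝ}
    (hc : c < 0) (x y : ℝ) :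
    HasDerivAt (fun x => ∫ t in c..y, W1 (x, t))
      (-((k : ℂ) ^ 2 * ∫ t in c..y, W (x, t)) - W2 (x, y) + W2 (x, c)) x := by
  have hW := S.cont
  have hW1 := S.cont1
  have hfc := S.continuous_graph
  obtain ⟨K, hK⟩ := S.lipschitz
  have hcf : ∀ x, c ≤ f x := fun x => hc.le.trans (S.nonneg x)
  have hb0 : ∀ x y, y ≤ f x → W1 (x, y) = 0 := fun x y h => by
    rw [S.below1 x y h, S.boundary1_eq_zero]
  have hb2 : ∀ x y, y ≤ f x → W2 (x, y) = 0 := fun x y h => by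
    rw [S.below2 x y h, S.boundary2_eq_zero]
  have hsplit : ∀ {G : ℝ × ℝ → ℂ}, Continuous G → (∀ x y, y ≤ f x → G (x, y) = 0) → ∀ z b,
      (∫ t in c..b, G (z, t)) = ∫ t in f z..b, G (z, t) := by
    intro G hG h0 z b
    have hi : ∀ p q, IntervalIntegrable (fun t => G (z, t)) volume p q := fun p q =>
      Continuous.intervalIntegrable (by fun_prop) _ _
    rw [← integral_add_adjacent_intervals (hi c (f z)) (hi (f z) b)]
    have : ∫ t in c..f z, G (z, t) = ∫ t in c..f z, (0 : ℂ) := integral_congr fun t ht => by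
      rw [uIcc_of_le (hcf z)] at ht; exact h0 z t ht.2
    rw [this, intervalIntegral.integral_zero, zero_add]
  rw [hb2 x c (hcf x), add_zero, hsplit hW S.zero_below]
  simp only [hsplit hW1 hb0]
  rcases lt_or_ge (f x) y with hy | hy
  · rw [hasDerivAt_iff_isLittleO]
    have := S.hasDerivAt_integral_above hK (fun _ => le_rfl) hy
    simpa [S.boundary1_eq_zero, S.boundary2_eq_zero] using this
  · have h0 : ∀ {G : ℝ × ℝ → ℂ}, (∀ x y, y ≤ f x → G (x, y) = 0) → ∫ t in f x..y, G (x, t) = 0 := by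
      intro G h
      rw [← intervalIntegral.integral_zero (a := f x) (b := y) (μ := volume)]
      exact integral_congr fun t ht => by rw [uIcc_of_ge hy] at ht; exact h x t ht.2
    rw [h0 S.zero_below, hb2 x y hy, mul_zero, neg_zero, sub_zero, hasDerivAt_iff_isLittleO,
      h0 hb0]
    simp only [smul_zero, sub_zero]
    refine isLittleO_iff.2 fun ε hε => ?_
    have hε' : 0 < ε / (K + 1) := by positivity
    obtain ⟨ρ, hρ, hball⟩ := Metric.continuousAt_iff.1 (hW1.continuousAt (x := (x, y)))
      (ε / (K + 1)) hε'
    have hr : 0 < ρ / (K + 1) := by positivity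
    filter_upwards [Metric.ball_mem_nhds x hr] with z hz
    rw [Metric.mem_ball, lt_div_iff₀ (by positivity)] at hz
    rcases le_or_gt y (f z) with hzy | hzy
    · have : ∫ t in f z..y, W1 (z, t) = ∫ t in f z..y, (0 : ℂ) := integral_congr fun t ht => by
        rw [uIcc_of_ge hzy] at ht; exact hb0 z t ht.2
      rw [this, intervalIntegral.integral_zero, norm_zero]
      positivity
    · have hKz : y - f z ≤ K * dist z x := by
        have := hK.dist_le_mul x z
        rw [Real.dist_eq, dist_comm] at this
        linarith [le_abs_self (f x - f z)]
      have hd := dist_nonneg (x := z) (y := x)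
      have hKd : 0 ≤ K * dist z x := by positivity
      refine (intervalIntegral.norm_integral_le_of_norm_le_const (C := ε / (K + 1))
        fun t ht => ?_).trans ?_
      · rw [uIoc_of_le hzy.le] at ht
        have : dist (z, t) (x, y) < ρ := by
          rw [Prod.dist_eq]
          refine max_lt (by dsimp only; nlinarith) ?_
          dsimp only
          rw [Real.dist_eq, abs_sub_comm, abs_of_nonneg (by linarith [ht.2])]
          linarith [ht.1]
        have := hball this
        rw [hb0 x y hy, dist_zero_right] at this
        exact this.le
      · rw [abs_of_pos (by linarith), ← dist_eq_norm]
        calc _ ≤ ε / (K + 1) * ((K + 1) * dist z x) := by gcongr; linarith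
          _ = _ := by field_simp

theorem charCoeff_eq_zero (S : IsExtendedSolution L k κ f W W1 W2 W11 W22) (j : ℤ) {y : ℝ}
    (hy : 0 ≤ y) : charCoeff L W (κ + 2 * Real.pi * j / L) y = 0 := by
  set lam := κ + 2 * Real.pi * j / L
  have hc : (-1 : ℝ) < 0 := by norm_num
  have hu : ∀ t, -1 < t → HasDerivAt (charCoeff L W lam) (charCoeff L W2 lam t) t := fun t ht =>
    hasDerivAt_charCoeff lam S.cont S.cont2 (fun p _ => S.hasDerivAt_snd p) ht
  have hv : ∀ t, -1 < t → HasDerivAt (charCoeff L W2 lam)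
      (((lam ^ 2 - k ^ 2 : ℝ) : ℂ) * charCoeff L W lam t) t := fun t ht =>
    hasDerivAt_charCoeff_snd S.cont S.cont1 S.cont2 (fun p _ => S.hasDerivAt_fst p)
      (fun y => mul_char_eq_of_quasiperiodic S.pos.ne' j (g := fun x => W (x, y))
        fun x => S.quasi x y)
      (fun y => mul_char_eq_of_quasiperiodic S.pos.ne' j (g := fun x => W1 (x, y))
        fun x => S.quasi1 x y) (fun x y _ => S.hasDerivAt_integral_fst hc x y) ht
  have h0 : charCoeff L W lam 0 = 0 ∧ charCoeff L W2 lam 0 = 0 := by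
    have h1 : ∀ x, W (x, 0) = 0 := fun x => S.zero_below x 0 (S.nonneg x)
    have h2 : ∀ x, W2 (x, 0) = 0 := fun x => by
      rw [S.below2 x 0 (S.nonneg x), S.boundary2_eq_zero]
    simp [charCoeff, h1, h2]
  have key := eq_zero_of_abs_deriv_le_mul_abs_self_of_eq_zero_right
    (f := fun t => (charCoeff L W lam t, charCoeff L W2 lam t))
    (f' := fun t => (charCoeff L W2 lam t, ((lam ^ 2 - k ^ 2 : ℝ) : ℂ) * charCoeff L W lam t))
    (K := 1 + |lam ^ 2 - k ^ 2|) (a := 0) (b := y)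
    ((continuous_charCoeff L S.cont lam).prodMk (continuous_charCoeff L S.cont2 lam)).continuousOn
    (fun t ht => ((hu t (by linarith [ht.1])).prodMk (hv t (by linarith [ht.1]))).hasDerivWithinAt)
    (by simp [h0.1, h0.2]) (fun t _ => ?_) y ⟨hy, le_rfl⟩
  · exact (Prod.ext_iff.1 key).1
  · rw [Prod.norm_def, Prod.norm_def, norm_mul, Complex.norm_real, Real.norm_eq_abs]
    dsimp only
    have hm := abs_nonneg (lam ^ 2 - k ^ 2)
    refine max_le ?_ ?_
    · exact (le_max_right _ _).trans (le_mul_of_one_le_left (by positivity) (by linarith))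
    · exact mul_le_mul (by linarith) (le_max_left _ _) (norm_nonneg _) (by linarith)

theorem eq_zero (S : IsExtendedSolution L k κ f W W1 W2 W11 W22) (p : ℝ × ℝ) : W p = 0 := by
  obtain ⟨x, y⟩ := p
  have hW := S.cont
  rcases le_total y (f x) with hy | hy
  · exact S.zero_below x y hy
  have hy0 : 0 ≤ y := (S.nonneg x).trans hy
  refine eq_zero_of_quasiperiodic S.pos (Complex.exp_ne_zero (κ * L * Complex.I))
    (g := fun x => W (x, y)) (fun x => S.quasi x y) (fun z hz => ?_) x
  have hs := hasSum_inner_quasiFourier S.pos κ (g := fun x => W (x, y)) (h := fun x => W (x, y))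
    (by fun_prop) (by fun_prop)
  have h0 : ∀ j : ℤ, ⟪charCoeff L W (κ + 2 * Real.pi * j / L) y,
      charCoeff L W (κ + 2 * Real.pi * j / L) y⟫_ℝ = 0 := fun j => by
    rw [S.charCoeff_eq_zero j hy0, inner_zero_left]
  have h1 := hs.tsum_eq.symm.trans ((tsum_congr h0).trans tsum_zero)
  have h2 := (mul_eq_zero.1 h1).resolve_left S.pos.ne'
  by_contra hne
  refine h2.not_gt (intervalIntegral.integral_pos S.pos (by fun_prop)
    (fun _ _ => real_inner_self_nonneg) ⟨z, hz, real_inner_self_pos.2 hne⟩)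

end IsExtendedSolution

end

/- STATEMENT 11 (Uniqueness for the quasiperiodic Dirichlet problem, Lemma 2.2):
Context: L > 0, k > 0, θ ∈ (0,π/2), ν = e^{ikL cos θ}; λ_j = k cos θ + 2πj/L with
λ_j² ≠ k² for all j; f : ℝ → ℝ Lipschitz, L-periodic, nonnegative;
D = {(x,y) : y > f(x)} with closure Dbar = {y ≥ f(x)},
D_L = {(x,y) : 0 ≤ x ≤ L, y ≥ f(x)}.
Suppose w is continuous on Dbar, continuously differentiable up to the boundary
(partials w1, w2 continuous on Dbar), twice continuously differentiable in D,
Δw + k²w = 0 in D, w = 0 on S, quasiperiodic, and ∫_{D_L}|w|² dx dy < ∞.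
Then w ≡ 0 in D. -/
theorem statement11
    (L k θ : ℝ) (hL : 0 < L) (hk : 0 < k) (hθ : θ ∈ Set.Ioo 0 (Real.pi / 2))
    (ν : ℂ) (hν : ν = Complex.exp (Complex.I * k * L * Real.cos θ))
    (hnr : ∀ j : ℤ, (k * Real.cos θ + 2 * Real.pi * j / L) ^ 2 ≠ k ^ 2)
    (f : ℝ → ℝ) (hlip : ∃ K : NNReal, LipschitzWith K f)
    (hper : ∀ x : ℝ, f (x + L) = f x) (hpos : ∀ x : ℝ, 0 ≤ f x)
    (D Dbar DL : Set (ℝ × ℝ))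
    (hD : D = {p : ℝ × ℝ | f p.1 < p.2})
    (hDbar : Dbar = {p : ℝ × ℝ | f p.1 ≤ p.2})
    (hDL : DL = {p : ℝ × ℝ | 0 ≤ p.1 ∧ p.1 ≤ L ∧ f p.1 ≤ p.2})
    (w w1 w2 w11 w22 : ℝ × ℝ → ℂ)
    (hcontw : ContinuousOn w Dbar)
    (hcontw1 : ContinuousOn w1 Dbar) (hcontw2 : ContinuousOn w2 Dbar)
    (hd1 : ∀ p ∈ Dbar, HasDerivAt (fun t => w (t, p.2)) (w1 p) p.1)
    (hd2 : ∀ p ∈ Dbar, HasDerivAt (fun t => w (p.1, t)) (w2 p) p.2)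
    (hd11 : ∀ p ∈ D, HasDerivAt (fun t => w1 (t, p.2)) (w11 p) p.1)
    (hd22 : ∀ p ∈ D, HasDerivAt (fun t => w2 (p.1, t)) (w22 p) p.2)
    (hcontw11 : ContinuousOn w11 D) (hcontw22 : ContinuousOn w22 D)
    (helm : ∀ p ∈ D, w11 p + w22 p + (k : ℂ) ^ 2 * w p = 0)
    (hdir : ∀ x : ℝ, w (x, f x) = 0)
    (hqp : ∀ p ∈ Dbar, w (p.1 + L, p.2) = ν * w p)
    (hqp1 : ∀ p ∈ Dbar, w1 (p.1 + L, p.2) = ν * w1 p)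
    (hL2 : IntegrableOn (fun p : ℝ × ℝ => ‖w p‖ ^ 2) DL volume) :
    ∀ p ∈ D, w p = 0 := by
  subst hD hDbar hDL
  obtain ⟨K, hK⟩ := hlip
  have hfc := hK.continuous
  have hc : Continuous fun p : ℝ × ℝ => (p.1, max p.2 (f p.1)) := by fun_prop
  have hmem : ∀ p : ℝ × ℝ, (p.1, max p.2 (f p.1)) ∈ {p : ℝ × ℝ | f p.1 ≤ p.2} := fun p =>
    le_max_right p.2 (f p.1)
  have habove : ∀ (g : ℝ × ℝ → ℂ) (x y : ℝ), f x ≤ y → g (x, max y (f x)) = g (x, y) :=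
    fun g x y h => by rw [max_eq_left h]
  have hbelow : ∀ (g : ℝ × ℝ → ℂ) (x y : ℝ), y ≤ f x → g (x, max y (f x)) = g (x, f x) :=
    fun g x y h => by rw [max_eq_right h]
  have hnear1 : ∀ (g : ℝ × ℝ → ℂ) (p : ℝ × ℝ), f p.1 < p.2 →
      (fun t => g (t, max p.2 (f t))) =ᶠ[nhds p.1] fun t => g (t, p.2) := fun g p hp => by
    filter_upwards [hfc.continuousAt.eventually (gt_mem_nhds hp)] with t ht
    exact habove g t p.2 (le_of_lt ht)
  have hnear2 : ∀ (g : ℝ × ℝ → ℂ) (p : ℝ × ℝ), f p.1 < p.2 →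
      (fun t => g (p.1, max t (f p.1))) =ᶠ[nhds p.2] fun t => g (p.1, t) := fun g p hp => by
    filter_upwards [lt_mem_nhds hp] with t ht
    exact habove g p.1 t (le_of_lt ht)
  have hν' : ν = Complex.exp ((k * Real.cos θ : ℝ) * L * Complex.I) := by
    rw [hν]; congr 1; push_cast; ring
  have hquasi : ∀ x y, w (x + L, max y (f (x + L))) = ν * w (x, max y (f x)) := fun x y => by
    rw [hper]; exact hqp _ (hmem (x, y))
  have hderiv2 : ∀ p : ℝ × ℝ, f p.1 < p.2 → HasDerivAt (fun t => w (p.1, max t (f p.1)))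
      (w2 (p.1, max p.2 (f p.1))) p.2 := fun p hp => by
    rw [habove w2 p.1 p.2 hp.le]
    exact (hd2 p hp.le).congr_of_eventuallyEq (hnear2 w p hp)
  have hcont2 : Continuous fun p : ℝ × ℝ => w2 (p.1, max p.2 (f p.1)) :=
    hcontw2.comp_continuous hc hmem
  have hquasi2 : ∀ x y, w2 (x + L, max y (f (x + L))) = ν * w2 (x, max y (f x)) := by
    intro x
    have hIoi : ∀ y, f x < y → w2 (x + L, max y (f (x + L))) = ν * w2 (x, max y (f x)) := by
      intro y hy
      have h1 := hderiv2 (x + L, y) (by simpa only [hper] using hy)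
      simp only [hquasi] at h1
      exact h1.unique ((hderiv2 (x, y) hy).const_mul ν)
    have hcl : IsClosed {y | w2 (x + L, max y (f (x + L))) = ν * w2 (x, max y (f x))} :=
      isClosed_eq (hcont2.comp (by fun_prop : Continuous fun y : ℝ => (x + L, y)))
        (continuous_const.mul (hcont2.comp (by fun_prop : Continuous fun y : ℝ => (x, y))))
    have hIci : ∀ y, f x ≤ y → w2 (x + L, max y (f (x + L))) = ν * w2 (x, max y (f x)) :=
      fun y hy => hcl.closure_subset_iff.2 (show Set.Ioi (f x) ⊆ _ from hIoi) (by rw [closure_Ioi]; exact hy)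
    intro y
    rcases le_total (f x) y with hy | hy
    · exact hIci y hy
    · have := hIci (f x) le_rfl
      rw [hper, max_self] at this
      rw [hper, max_eq_right hy, this]
  have hS : IsExtendedSolution L k (k * Real.cos θ) f (fun p => w (p.1, max p.2 (f p.1)))
      (fun p => w1 (p.1, max p.2 (f p.1))) (fun p => w2 (p.1, max p.2 (f p.1))) w11 w22 :=
    { pos := hL
      nonresonant := hnr
      lipschitz := ⟨K, hK⟩
      periodic := hper
      nonneg := hpos
      cont := hcontw.comp_continuous hc hmem
      cont1 := hcontw1.comp_continuous hc hmem
      cont2 := hcont2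
      cont11 := hcontw11
      cont22 := hcontw22
      deriv1 := fun p hp => by
        rw [habove w1 p.1 p.2 hp.le]
        exact (hd1 p hp.le).congr_of_eventuallyEq (hnear1 w p hp)
      deriv2 := hderiv2
      deriv11 := fun p hp => (hd11 p hp).congr_of_eventuallyEq (hnear1 w1 p hp)
      deriv22 := fun p hp => (hd22 p hp).congr_of_eventuallyEq (hnear2 w2 p hp)
      helmholtz := fun p hp => by
        rw [habove w p.1 p.2 hp.le]
        exact eq_neg_of_add_eq_zero_left (helm p hp)
      zero_below := fun x y hy => (hbelow w x y hy).trans (hdir x)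
      below1 := fun x y hy => by simp only [max_self, max_eq_right hy]
      below2 := fun x y hy => by simp only [max_self, max_eq_right hy]
      boundary1 := fun x h0 => by
        simp only [max_self] at h0
        have h1 : HasDerivAt (fun t => w (t, f x)) (w1 (x, f x)) x := hd1 (x, f x) (le_refl (f x))
        rw [h0, hasDerivAt_iff_isLittleO] at h1
        simp only [hdir, smul_zero, sub_zero] at h1
        rw [hasDerivAt_iff_isLittleO]
        refine Asymptotics.IsBigO.trans_isLittleO (Asymptotics.isBigO_of_le _ fun t => ?_) h1
        simp only [max_self, hdir, smul_zero, sub_zero]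
        rcases le_total (f t) (f x) with h | h
        · rw [max_eq_left h]
        · rw [max_eq_right h, hdir, norm_zero]
          exact norm_nonneg _
      boundary2 := fun x => by
        simp only [max_self]
        exact (hd2 (x, f x) (le_refl (f x))).hasDerivWithinAt.congr
          (fun t ht => habove w x t ht) (habove w x _ le_rfl)
      quasi := fun x y => hν' ▸ hquasi x y
      quasi1 := fun x y => by
        simp only [hper, ← hν']
        exact hqp1 _ (hmem (x, y))
      quasi2 := fun x y => hν' ▸ hquasi2 x y
      sq_integrable := by
        refine hL2.congr_fun (fun p hp => ?_) ?_
        · simp only [habove w p.1 p.2 hp.2.2]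
        · have h1 : IsClosed {p : ℝ × ℝ | 0 ≤ p.1} := isClosed_le (by fun_prop) (by fun_prop)
          have h2 : IsClosed {p : ℝ × ℝ | p.1 ≤ L} := isClosed_le (by fun_prop) (by fun_prop)
          have h3 : IsClosed {p : ℝ × ℝ | f p.1 ≤ p.2} := isClosed_le (by fun_prop) (by fun_prop)
          exact (h1.inter (h2.inter h3)).measurableSet }
  intro p hp
  rw [← habove w p.1 p.2 (le_of_lt hp)]
  exact hS.eq_zero p
end
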